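/- arXiv:1401.2436 — 3 statements merged into one kernel-verified Lean document; each statement's English description precedes it below -/
import Mathlib

section
/- For all sufficiently large n the following holds: if m = cn with 10⁴ ≤ c ≤ n/10¹⁰ and β* = max{e^{−c/6}, 1/n}, then with probability at least 1 − n⁻¹⁵ over G drawn from G_{n,m}, for every β with β* ≤ β ≤ 1, the graph G is (β, β/240)-asymmetric. -/
open scoped Classical

noncomputable section

namespace Giso

/-- Probability of `P` under the uniform distribution on the finite set `s`. -/
def prob {Ω : Type*} (s : Finset Ω) (P : Ω → Prop) : ℝ :=
  ((s.filter P).card : ℝ) / (s.card : ℝ)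

/-- The sample space of `G_{n,m}`: edge sets of simple graphs on `[n]` with exactly
`m` edges. -/
def graphSpace (n m : ℕ) : Finset (Finset (Sym2 (Fin n))) :=
  Finset.univ.filter fun E => E.card = m ∧ ∀ e ∈ E, ¬ e.IsDiag

/-- Number of fixed points of a permutation of `[n]`. -/
def fixedCount {n : ℕ} (π : Equiv.Perm (Fin n)) : ℕ :=
  (Finset.univ.filter fun v => π v = v).card

/-- `AUT(G;π)`: the fraction of edges `e` of the graph with `π(e)` again an edge. -/
def gAut {n : ℕ} (E : Finset (Sym2 (Fin n))) (π : Equiv.Perm (Fin n)) : ℝ :=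
  ((E.filter fun e => Sym2.map (fun x => π x) e ∈ E).card : ℝ) / (E.card : ℝ)

/-- `(β,γ)`-asymmetry: every permutation with at most `(1−β)n` fixed points satisfies
`AUT(G;π) < 1 − γ`. -/
def gAsymmetric {n : ℕ} (E : Finset (Sym2 (Fin n))) (β γ : ℝ) : Prop :=
  ∀ π : Equiv.Perm (Fin n), (fixedCount π : ℝ) ≤ (1 - β) * n → gAut E π < 1 - γ


def MU {α : Type*} [DecidableEq α] (U : Finset α) (p : ℝ) (P : Finset α → Prop) : ℝ :=
  ∑ E ∈ U.powerset.filter P, p ^ E.card * (1 - p) ^ (U \ E).card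

lemma MU_union {α ι : Type*} [DecidableEq α] (U : Finset α) (p : ℝ) (hp0 : 0 ≤ p) (hp1 : p ≤ 1)
    (P : Finset α → Prop) (I : Finset ι) (Q : ι → Finset α → Prop)
    (h : ∀ E ⊆ U, P E → ∃ i ∈ I, Q i E) : MU U p P ≤ ∑ i ∈ I, MU U p (Q i) := by
  unfold MU
  have hq : 0 ≤ 1 - p := by linarith
  simp only [Finset.sum_filter]
  rw [Finset.sum_comm]
  apply Finset.sum_le_sum
  intro E hE
  have hw : 0 ≤ p ^ E.card * (1 - p) ^ (U \ E).card := by positivity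
  by_cases hP : P E
  · obtain ⟨i, hi, hQ⟩ := h E (Finset.mem_powerset.1 hE) hP
    rw [if_pos hP]
    calc _ = (if Q i E then p ^ E.card * (1 - p) ^ (U \ E).card else 0) := by rw [if_pos hQ]
      _ ≤ _ := Finset.single_le_sum
          (f := fun i => if Q i E then p ^ E.card * (1 - p) ^ (U \ E).card else 0)
          (fun j _ => by split_ifs <;> first | exact hw | exact le_rfl) hi
  · rw [if_neg hP]
    exact Finset.sum_nonneg (fun j _ => by split_ifs <;> first | exact hw | exact le_rfl)

lemma MU_or {α : Type*} [DecidableEq α] (U : Finset α) (p : ℝ) (hp0 : 0 ≤ p) (hp1 : p ≤ 1)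
    (P Q : Finset α → Prop) : MU U p (fun E => P E ∨ Q E) ≤ MU U p P + MU U p Q := by
  have := MU_union U p hp0 hp1 (fun E => P E ∨ Q E) (Finset.univ : Finset Bool)
    (fun b => if b then P else Q) (by
      intro E _ h
      rcases h with h | h
      · exact ⟨true, by simp, by simpa using h⟩
      · exact ⟨false, by simp, by simpa using h⟩)
  simpa using this

lemma MU_superset {α : Type*} [DecidableEq α] (U : Finset α) (p : ℝ) (D : Finset α) (hD : D ⊆ U) :
    MU U p (fun E => D ⊆ E) ≤ p ^ D.card := by
  unfold MU
  have h := Finset.prod_add (fun _ : α => p) (fun i => if i ∈ D then 0 else 1 - p) U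
  have h1 : ∏ i ∈ U, (p + if i ∈ D then 0 else 1 - p) = p ^ D.card := by
    have : ∀ i ∈ U, (p + if i ∈ D then 0 else 1 - p) = if i ∈ D then p else 1 := by
      intro i _; split_ifs <;> ring
    rw [Finset.prod_congr rfl this, Finset.prod_ite]
    simp [Finset.filter_mem_eq_inter, Finset.inter_eq_right.2 hD]
  rw [h1] at h
  rw [h, Finset.sum_filter]
  apply Finset.sum_le_sum
  intro E hE
  split_ifs with hs
  · rw [Finset.prod_const, Finset.prod_congr rfl (g := fun _ => 1 - p), Finset.prod_const]
    intro i hi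
    rw [if_neg]
    intro h; exact (Finset.mem_sdiff.1 hi).2 (hs h)
  · obtain ⟨d, hd, hdE⟩ := Finset.not_subset.1 hs
    rw [Finset.prod_eq_zero (i := d) (s := U \ E) (Finset.mem_sdiff.2 ⟨hD hd, hdE⟩) (by simp [hd])]
    simp

lemma MU_lower {α : Type*} [DecidableEq α] (U : Finset α) (p : ℝ) (hp0 : 0 ≤ p) (hp1 : p ≤ 1)
    (T : Finset α) (hT : T ⊆ U) (L : ℝ) :
    MU U p (fun E => ((E ∩ T).card : ℝ) ≤ L) ≤
      Real.exp (4 * L - 0.98 * (p * T.card)) := by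
  unfold MU
  set y := Real.exp (-4) with hy
  have hq : 0 ≤ 1 - p := by linarith
  have hy0 : 0 < y := Real.exp_pos _
  have hy1 : y ≤ 0.02 := by
    rw [hy, Real.exp_neg, inv_le_comm₀ (Real.exp_pos _) (by norm_num)]
    have h4 : Real.exp 4 = Real.exp 1 ^ 4 := by rw [← Real.exp_nat_mul]; norm_num
    rw [h4]
    calc (0.02:ℝ)⁻¹ ≤ 2.7 ^ 4 := by norm_num
      _ ≤ _ := by gcongr; linarith [Real.exp_one_gt_d9]
  have h := Finset.prod_add (fun i : α => if i ∈ T then p * y else p) (fun _ => 1 - p) U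
  have h1 : ∏ i ∈ U, ((if i ∈ T then p * y else p) + (1 - p)) = (1 - p + p * y) ^ T.card := by
    have : ∀ i ∈ U, ((if i ∈ T then p * y else p) + (1 - p)) = if i ∈ T then 1 - p + p * y else 1 := by
      intro i _; split_ifs <;> ring
    rw [Finset.prod_congr rfl this, Finset.prod_ite]
    simp [Finset.filter_mem_eq_inter, Finset.inter_eq_right.2 hT]
  rw [h1] at h
  have h2 : ∀ E : Finset α, ∏ i ∈ E, (if i ∈ T then p * y else p) = p ^ E.card * y ^ (E ∩ T).card := by
    intro E
    have : ∀ i ∈ E, (if i ∈ T then p * y else p) = p * (if i ∈ T then y else 1) := by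
      intro i _; split_ifs <;> ring
    rw [Finset.prod_congr rfl this, Finset.prod_mul_distrib, Finset.prod_const, Finset.prod_ite]
    simp [Finset.filter_mem_eq_inter]
  have h3 : (1 - p + p * y) ^ T.card ≤ Real.exp (- 0.98 * (p * T.card)) := by
    have : 1 - p + p * y ≤ Real.exp (-0.98 * p) := by
      have := Real.add_one_le_exp (-0.98 * p)
      nlinarith
    calc _ ≤ (Real.exp (-0.98 * p)) ^ T.card := by
          gcongr
      _ = _ := by rw [← Real.exp_nat_mul]; ring_nf
  calc _ ≤ Real.exp (4 * L) * (1 - p + p * y) ^ T.card := by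
        rw [h, Finset.sum_filter, Finset.mul_sum]
        apply Finset.sum_le_sum
        intro E hE
        rw [h2, Finset.prod_const]
        split_ifs with hs
        · have : 1 ≤ Real.exp (4 * L) * y ^ (E ∩ T).card := by
            rw [hy, ← Real.exp_nat_mul, ← Real.exp_add]
            apply Real.one_le_exp
            linarith
          have hw : 0 ≤ p ^ E.card * (1 - p) ^ (U \ E).card := by positivity
          nlinarith
        · positivity
    _ ≤ Real.exp (4 * L) * Real.exp (- 0.98 * (p * T.card)) := by gcongr
    _ = _ := by rw [← Real.exp_add]; ring_nf

lemma max_term (N m : ℕ) (hm : m ≤ N) (p : ℝ) (hp0 : 0 < p) (hp1 : p < 1) (hpm : p * N = m) :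
    1 ≤ ((N : ℝ) + 1) * (N.choose m * (p ^ m * (1 - p) ^ (N - m))) := by
  have hq : 0 < 1 - p := by linarith
  set b : ℕ → ℝ := fun j => N.choose j * (p ^ j * (1 - p) ^ (N - j)) with hb
  have hb0 : ∀ j, 0 ≤ b j := fun j => by simp only [hb]; positivity
  have hrec : ∀ j, j < N → b (j+1) * ((j+1) * (1 - p)) = b j * ((N - j) * p) := by
    intro j hj
    simp only [hb]
    have h1 := Nat.choose_succ_right_eq N j
    have h2 : (N.choose (j+1) : ℝ) * (j+1) = N.choose j * (N - j) := by
      have := congrArg (Nat.cast : ℕ → ℝ) h1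
      push_cast [Nat.cast_sub hj.le] at this
      exact this
    have h3 : N - j = N - (j+1) + 1 := by omega
    rw [h3, pow_succ, pow_succ]
    linear_combination (p ^ j * p * (1-p)^(N-(j+1)) * (1 - p)) * h2
  have up : ∀ j, j < m → b j ≤ b (j+1) := by
    intro j hj
    have hj' : (j:ℝ) + 1 ≤ m := by exact_mod_cast hj
    have h := hrec j (by omega)
    have hpos : 0 < ((j:ℝ)+1) * (1-p) := by positivity
    have : ((j:ℝ)+1) * (1-p) ≤ (N - j) * p := by nlinarith
    refine le_of_mul_le_mul_right ?_ hpos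
    rw [h]
    exact mul_le_mul_of_nonneg_left this (hb0 j)
  have down : ∀ j, m ≤ j → j < N → b (j+1) ≤ b j := by
    intro j hj hjN
    have hj' : (m:ℝ) ≤ j := by exact_mod_cast hj
    have h := hrec j (by omega)
    have hpos : 0 < ((j:ℝ)+1) * (1-p) := by positivity
    have : (N - j) * p ≤ ((j:ℝ)+1) * (1-p) := by nlinarith
    refine le_of_mul_le_mul_right ?_ hpos
    rw [h]
    exact mul_le_mul_of_nonneg_left this (hb0 j)
  have hmax : ∀ j, j ≤ N → b j ≤ b m := by
    intro j hj
    rcases le_total j m with h | h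
    · obtain ⟨d, rfl⟩ := Nat.exists_eq_add_of_le h
      have : ∀ d, ∀ j, (∀ i, i < j + d → b i ≤ b (i+1)) → b j ≤ b (j+d) := by
        intro d
        induction d with
        | zero => intro j _; exact le_rfl
        | succ d ih =>
          intro j hh
          exact (ih j (fun i hi => hh i (by omega))).trans (hh (j+d) (by omega))
      exact this d j up
    · induction j, h using Nat.le_induction with
      | base => exact le_rfl
      | succ j hj' ih => exact (down j hj' (by omega)).trans (ih (by omega))
  have hsum : ∑ j ∈ Finset.range (N+1), b j = 1 := by
    have := add_pow p (1 - p) N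
    rw [show p + (1 - p) = 1 by ring, one_pow] at this
    rw [this]
    apply Finset.sum_congr rfl
    intro j _
    simp only [hb]; ring
  calc (1:ℝ) = ∑ j ∈ Finset.range (N+1), b j := hsum.symm
    _ ≤ ∑ j ∈ Finset.range (N+1), b m :=
        Finset.sum_le_sum (fun j hj => hmax j (by simpa [Nat.lt_succ_iff] using hj))
    _ = _ := by simp [hb]

lemma transfer {α : Type*} [DecidableEq α] (U : Finset α) (m : ℕ) (hm : m ≤ U.card) (p : ℝ) (hp0 : 0 < p)
    (hp1 : p < 1) (hpm : p * U.card = m) (P : Finset α → Prop) :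
    (((U.powersetCard m).filter P).card : ℝ) ≤
      ((U.card : ℝ) + 1) * U.card.choose m * MU U p P := by
  have hq : 0 < 1 - p := by linarith
  have h1 : (((U.powersetCard m).filter P).card : ℝ) * (p ^ m * (1 - p) ^ (U.card - m)) ≤ MU U p P := by
    unfold MU
    rw [← nsmul_eq_mul, ← Finset.sum_const]
    calc _ = ∑ E ∈ (U.powersetCard m).filter P, p ^ E.card * (1 - p) ^ (U \ E).card := by
          apply Finset.sum_congr rfl
          intro E hE
          simp only [Finset.mem_filter, Finset.mem_powersetCard] at hE
          rw [Finset.card_sdiff_of_subset hE.1.1, hE.1.2]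
      _ ≤ _ := by
          apply Finset.sum_le_sum_of_subset_of_nonneg
          · intro E hE
            simp only [Finset.mem_filter, Finset.mem_powersetCard, Finset.mem_powerset] at hE ⊢
            exact ⟨hE.1.1, hE.2⟩
          · intros; positivity
  have h2 := max_term U.card m hm p hp0 hp1 hpm
  set X : ℝ := (((U.powersetCard m).filter P).card : ℝ)
  have hX : 0 ≤ X := Nat.cast_nonneg _
  calc X = X * 1 := by ring
    _ ≤ X * (((U.card : ℝ) + 1) * (U.card.choose m * (p ^ m * (1 - p) ^ (U.card - m)))) := by gcongr
    _ = ((U.card : ℝ) + 1) * U.card.choose m * (X * (p ^ m * (1 - p) ^ (U.card - m))) := by ring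
    _ ≤ _ := by gcongr

lemma extract {α : Type*} [DecidableEq α] (σ : α → α) (hσ : Function.Injective σ) (B : Finset α)
    (hB : ∀ b ∈ B, σ b ≠ b) : ∃ F ⊆ B, Disjoint F (F.image σ) ∧ B.card ≤ 3 * F.card := by
  obtain ⟨F, hF, hmax⟩ := Finset.exists_max_image (B.powerset.filter (fun F => Disjoint F (F.image σ)))
    Finset.card ⟨∅, by simp⟩
  simp only [Finset.mem_filter, Finset.mem_powerset] at hF hmax
  refine ⟨F, hF.1, hF.2, ?_⟩
  have hsub : B ⊆ F ∪ F.image σ ∪ B.filter (fun b => σ b ∈ F) := by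
    intro b hb
    by_contra hcon
    simp only [Finset.mem_union, Finset.mem_filter, not_or, not_and] at hcon
    obtain ⟨⟨h1, h2⟩, h3⟩ := hcon
    have h3 := h3 hb
    have := hmax (insert b F) ⟨Finset.insert_subset hb hF.1, by
      rw [Finset.image_insert, Finset.disjoint_insert_left, Finset.disjoint_insert_right]
      refine ⟨?_, h3, hF.2⟩
      rw [Finset.mem_insert, not_or]
      exact ⟨fun h => hB b hb h.symm, h2⟩⟩
    rw [Finset.card_insert_of_notMem h1] at this
    omega
  have h1 := Finset.card_le_card hsub
  have h2 : (F.image σ).card ≤ F.card := Finset.card_image_le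
  have h3 : (B.filter (fun b => σ b ∈ F)).card ≤ F.card :=
    Finset.card_le_card_of_injOn σ (fun b hb => (Finset.mem_filter.1 hb).2) hσ.injOn
  have h4 := Finset.card_union_le (F ∪ F.image σ) (B.filter (fun b => σ b ∈ F))
  have h5 := Finset.card_union_le F (F.image σ)
  omega

lemma choose_exp (n k : ℕ) (hk : 0 < k) (hn : 0 < n) :
    (n.choose k : ℝ) ≤ (Real.exp 1 * n / k) ^ k := by
  have h1 := Nat.choose_le_pow_div (α := ℝ) k n
  have h2 := Real.pow_div_factorial_le_exp (x := (k:ℝ)) (by positivity) k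
  have hk' : (0:ℝ) < k := by exact_mod_cast hk
  have hf : (0:ℝ) < (k.factorial : ℝ) := by exact_mod_cast k.factorial_pos
  refine h1.trans ?_
  have h3 : Real.exp (k:ℝ) = Real.exp 1 ^ k := by rw [← Real.exp_nat_mul]; simp
  rw [h3] at h2
  rw [div_pow, mul_pow, div_le_div_iff₀ hf (by positivity)]
  rw [div_le_iff₀ hf] at h2
  have hnk : (0:ℝ) ≤ (n:ℝ)^k := by positivity
  nlinarith

lemma num1 (n k : ℕ) (c : ℝ) (hl : 50 ≤ Real.log n) (hn : 2 ≤ n) (hc : 10 ^ 4 ≤ c) (hk2 : 2 ≤ k)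
    (hkn : k ≤ n) (hkc : n * Real.exp (-c / 6) ≤ k) :
    (n.choose k : ℝ) * Real.exp (4 * (c * k / 100) -
      0.98 * (c * k * (2 * n - k - 1) / (n - 1))) ≤ Real.exp (-19 * Real.log n) := by
  have hk' : (2:ℝ) ≤ k := by exact_mod_cast hk2
  have hn' : (2:ℝ) ≤ n := by exact_mod_cast hn
  have hkn' : (k:ℝ) ≤ n := by exact_mod_cast hkn
  have hn0 : (0:ℝ) < n := by linarith
  have hk0 : (0:ℝ) < k := by linarith
  have hc0 : (0:ℝ) < c := by linarith
  set l := Real.log n with hldef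
  -- log form of the lower bound on k
  have hlog : l - c / 6 ≤ Real.log k := by
    have := Real.log_le_log (by positivity) hkc
    rw [Real.log_mul (by positivity) (by positivity), Real.log_exp] at this
    linarith
  have hch : (n.choose k : ℝ) ≤ Real.exp (k * (1 + c / 6)) := by
    refine (choose_exp n k (by omega) (by omega)).trans ?_
    rw [Real.exp_nat_mul]
    gcongr
    rw [Real.exp_add, mul_div_assoc]
    gcongr
    rw [div_le_iff₀ hk0]
    rw [neg_div, Real.exp_neg, mul_inv_le_iff₀ (Real.exp_pos _)] at hkc
    linarith
  have hln : l ≤ n := by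
    have := Real.log_le_sub_one_of_pos hn0
    linarith
  have hck0 : 0 < c * k := by positivity
  have hkck : (k:ℝ) ≤ c * k / 10 ^ 4 := by
    rw [le_div_iff₀ (by norm_num)]; nlinarith
  refine (mul_le_mul_of_nonneg_right hch (Real.exp_pos _).le).trans ?_
  rw [← Real.exp_add, Real.exp_le_exp]
  set R : ℝ := c * k * (2 * n - k - 1) / (n - 1) with hR
  by_cases hb : (k:ℝ) ≤ n / 10
  · have hR1 : 1.9 * (c * k) ≤ R := by
      rw [hR, le_div_iff₀ (by linarith)]
      nlinarith
    have hlow : 12 * l - 24 ≤ c * k := by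
      by_cases h6 : k ≤ 6
      · have h6' : (k:ℝ) ≤ 6 := by exact_mod_cast h6
        have : Real.log k ≤ 2 := by
          rw [Real.log_le_iff_le_exp hk0]
          have : Real.exp 2 = Real.exp 1 ^ 2 := by rw [← Real.exp_nat_mul]; norm_num
          rw [this]
          nlinarith [Real.exp_one_gt_d9]
        nlinarith
      · have h7 : (7:ℝ) ≤ k := by exact_mod_cast (by omega : 7 ≤ k)
        by_cases hs : (k:ℝ)^2 ≤ n
        · have := Real.log_le_log (by positivity) hs
          rw [Real.log_pow] at this
          push_cast at this
          nlinarith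
        · have := Real.log_le_log hn0 (not_le.1 hs).le
          rw [Real.log_pow] at this
          push_cast at this
          have h2 := Real.log_le_sub_one_of_pos hk0
          nlinarith
    nlinarith
  · have hR1 : c * k ≤ R := by
      rw [hR, le_div_iff₀ (by linarith)]
      nlinarith
    have : 10 ^ 3 * (n:ℝ) ≤ c * k := by nlinarith
    nlinarith

set_option maxHeartbeats 1000000 in
lemma num2 (n k T l' : ℕ) (c p : ℝ) (hl : 200 ≤ Real.log n)
    (hev : 13 * Real.log n ≤ 0.0019 * (n:ℝ) ^ (1/4:ℝ)) (hn : 100 ≤ n) (hc : 10 ^ 4 ≤ c)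
    (hcn : c ≤ (n:ℝ) / 10 ^ 10) (hk2 : 2 ≤ k) (hp : p = 2 * c / (n - 1))
    (hT : T ≤ k * n) (hl' : 0.0019 * (c * k) ≤ l') :
    (n.choose k : ℝ) * ((n:ℝ) ^ k * (T.choose l' * p ^ (2 * l'))) ≤ Real.exp (-19 * Real.log n) := by
  have hk' : (2:ℝ) ≤ k := by exact_mod_cast hk2
  have hn' : (100:ℝ) ≤ n := by exact_mod_cast hn
  have hT' : (T:ℝ) ≤ k * n := by exact_mod_cast hT
  have hn0 : (0:ℝ) < n := by linarith
  have hk0 : (0:ℝ) < k := by linarith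
  have hc0 : (0:ℝ) < c := by linarith
  have hl0 : (0:ℝ) < l' := lt_of_lt_of_le (by positivity) hl'
  have hp0 : 0 ≤ p := by rw [hp]; exact div_nonneg (by positivity) (by linarith)
  set l := Real.log n with hldef
  have hnexp : (n:ℝ) = Real.exp l := (Real.exp_log hn0).symm
  set r : ℝ := 6000 * c / n with hr
  have hr0 : 0 < r := by positivity
  have hbase : Real.exp 1 * (k * n : ℕ) / l' * p ^ 2 ≤ r := by
    have he : Real.exp 1 ≤ 2.7183 := by linarith [Real.exp_one_lt_d9]
    have h1 : Real.exp 1 * (k * n : ℕ) / l' ≤ 2.7183 * (k * n) / (0.0019 * (c * k)) := by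
      push_cast
      gcongr
    have hn1 : (0:ℝ) < n - 1 := by linarith
    calc _ ≤ 2.7183 * (k * n) / (0.0019 * (c * k)) * p ^ 2 := by gcongr
      _ = (2.7183 * 4 / 0.0019) * c * n / (n-1)^2 := by
          rw [hp]; field_simp; ring
      _ ≤ r := by
          rw [hr, div_le_div_iff₀ (by positivity) hn0]
          have : (2.7183 * 4 / 0.0019) * (n:ℝ)^2 ≤ 6000 * (n-1)^2 := by nlinarith
          nlinarith
  have hmain : (T.choose l' : ℝ) * p ^ (2 * l') ≤ r ^ l' := by
    have h1 : (T.choose l' : ℝ) ≤ ((k*n).choose l' : ℕ) := by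
      exact_mod_cast Nat.choose_le_choose l' hT
    have h2 := choose_exp (k * n) l' (by exact_mod_cast hl0) (by positivity)
    calc _ ≤ (Real.exp 1 * (k * n : ℕ) / l') ^ l' * p ^ (2 * l') := by
          gcongr; exact h1.trans h2
      _ = (Real.exp 1 * (k * n : ℕ) / l' * p ^ 2) ^ l' := by rw [mul_pow, pow_mul]
      _ ≤ _ := by gcongr
  have hrl : r ^ l' ≤ Real.exp (-13 * k * l) := by
    have : r ^ l' = Real.exp (l' * Real.log r) := by
      rw [Real.exp_nat_mul, Real.exp_log hr0]
    rw [this, Real.exp_le_exp]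
    have hlogr : Real.log r = Real.log 6000 + Real.log c - l := by
      rw [hr, Real.log_div (by positivity) (by positivity), Real.log_mul (by norm_num) (by positivity)]
    by_cases hcase : c ^ 4 ≤ n
    · have h1 := Real.log_le_log (by positivity) hcase
      rw [Real.log_pow] at h1
      push_cast at h1
      have h6 : Real.log 6000 ≤ 9 := by
        rw [Real.log_le_iff_le_exp (by norm_num)]
        have : Real.exp 9 = Real.exp 1 ^ 9 := by rw [← Real.exp_nat_mul]; norm_num
        rw [this]
        calc (6000:ℝ) ≤ 2.7 ^ 9 := by norm_num
          _ ≤ _ := by gcongr; linarith [Real.exp_one_gt_d9]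
      have h2 : Real.log r ≤ -0.7 * l := by linarith
      have h3 : 19 * (k:ℝ) ≤ l' := by nlinarith
      calc (l':ℝ) * Real.log r ≤ l' * (-0.7 * l) := by gcongr
        _ ≤ (19 * k) * (-0.7 * l) := by nlinarith
        _ ≤ _ := by nlinarith
    · have h2 : Real.log r ≤ -1 := by
        rw [Real.log_le_iff_le_exp hr0]
        have : r ≤ 6000 / 10 ^ 10 := by
          rw [hr, div_le_div_iff₀ hn0 (by norm_num)]
          rw [le_div_iff₀ (by norm_num)] at hcn
          nlinarith
        rw [Real.exp_neg]
        have h3 : (3:ℝ)⁻¹ ≤ (Real.exp 1)⁻¹ := by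
          apply inv_anti₀ (Real.exp_pos _)
          linarith [Real.exp_one_lt_d9]
        refine this.trans (le_trans ?_ h3)
        norm_num
      have h3 : (n:ℝ) ^ (1/4:ℝ) ≤ c := by
        calc (n:ℝ) ^ (1/4:ℝ) ≤ (c^4) ^ (1/4:ℝ) :=
              Real.rpow_le_rpow hn0.le (not_le.1 hcase).le (by norm_num)
          _ = c := by
            rw [← Real.rpow_natCast, ← Real.rpow_mul hc0.le]; norm_num
      have h4 : 13 * l * k ≤ 0.0019 * (c * k) := by
        have : 13 * l ≤ 0.0019 * c := by linarith
        nlinarith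
      have h5 : (l':ℝ) * Real.log r ≤ l' * (-1) := mul_le_mul_of_nonneg_left h2 hl0.le
      linarith
  have hch : (n.choose k : ℝ) ≤ (n:ℝ) ^ k := by
    exact_mod_cast Nat.choose_le_pow n k
  calc _ ≤ (n:ℝ)^k * ((n:ℝ) ^ k * Real.exp (-13 * k * l)) := by
        gcongr; exact hmain.trans hrl
    _ = Real.exp (-11 * k * l) := by
        have : (n:ℝ)^k = Real.exp (k * l) := by rw [Real.exp_nat_mul, ← hnexp]
        rw [this, ← Real.exp_add, ← Real.exp_add]; ring_nf
    _ ≤ _ := by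
        rw [Real.exp_le_exp]; nlinarith

def UU (n : ℕ) : Finset (Sym2 (Fin n)) := Finset.univ.filter fun e => ¬ e.IsDiag

def touch {n : ℕ} (S : Finset (Fin n)) : Finset (Sym2 (Fin n)) :=
  (UU n).filter fun e => ∃ v ∈ S, v ∈ e

lemma graphSpace_eq (n m : ℕ) : graphSpace n m = (UU n).powersetCard m := by
  ext E
  simp only [graphSpace, UU, Finset.mem_filter, Finset.mem_univ, true_and,
    Finset.mem_powersetCard, Finset.subset_iff]
  tauto

lemma card_avoid {n : ℕ} (A : Finset (Fin n)) :
    ((UU n).filter fun e => ∀ v ∈ e, v ∈ A).card = A.card.choose 2 := by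
  rw [← Sym2.card_image_offDiag A]
  congr 1
  ext e
  induction e using Sym2.ind with
  | _ a b =>
    simp only [UU, Finset.mem_filter, Finset.mem_univ, true_and, Sym2.mk_isDiag_iff, Sym2.mem_iff,
      forall_eq_or_imp, forall_eq, Finset.mem_image, Finset.mem_offDiag, Prod.exists,
      Function.uncurry_apply_pair, Sym2.eq_iff]
    constructor
    · rintro ⟨h1, h2, h3⟩
      exact ⟨a, b, ⟨h2, h3, h1⟩, Or.inl ⟨rfl, rfl⟩⟩
    · rintro ⟨x, y, ⟨h1, h2, h3⟩, (⟨rfl, rfl⟩ | ⟨rfl, rfl⟩)⟩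
      · exact ⟨h3, h1, h2⟩
      · exact ⟨fun h => h3 h.symm, h2, h1⟩

lemma card_UU (n : ℕ) : (UU n).card = n.choose 2 := by
  have := card_avoid (Finset.univ : Finset (Fin n))
  simpa using this

lemma card_touch {n : ℕ} (S : Finset (Fin n)) :
    ((touch S).card : ℝ) = S.card * (2 * n - S.card - 1) / 2 := by
  have h1 : (touch S).card + (Sᶜ.card.choose 2) = n.choose 2 := by
    rw [← card_UU n, ← card_avoid, touch,
      ← Finset.card_filter_add_card_filter_not (s := UU n) (fun e => ∃ v ∈ S, v ∈ e)]
    congr 2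
    ext e
    simp only [Finset.mem_filter, Finset.mem_compl, not_exists, not_and]
    refine and_congr_right (fun _ => ⟨fun h v hv hS => h v hS hv, fun h v hv hS => h v hS hv⟩)
  have hS : S.card ≤ n := by simpa using Finset.card_le_univ S
  have h2 : ((touch S).card : ℝ) + ((Sᶜ.card.choose 2 : ℕ) : ℝ) = (n.choose 2 : ℕ) := by exact_mod_cast h1
  rw [Nat.cast_choose_two, Nat.cast_choose_two, Finset.card_compl, Fintype.card_fin,
    Nat.cast_sub hS] at h2
  linarith

lemma touch_subset {n : ℕ} (S : Finset (Fin n)) : touch S ⊆ UU n := Finset.filter_subset _ _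

lemma card_touch_le {n : ℕ} (S : Finset (Fin n)) : (touch S).card ≤ S.card * n := by
  have h := card_touch S
  have : ((touch S).card : ℝ) ≤ S.card * n := by
    rw [h]
    have h0 : (0:ℝ) ≤ S.card := Nat.cast_nonneg _
    nlinarith
  exact_mod_cast this

def permsOn {n : ℕ} (S : Finset (Fin n)) : Finset (Equiv.Perm (Fin n)) :=
  Finset.univ.filter fun π => ∀ v, v ∉ S → π v = v

lemma card_permsOn {n : ℕ} (S : Finset (Fin n)) : (permsOn S).card ≤ n ^ S.card := by
  have h : (permsOn S).card ≤ (Finset.univ : Finset (S → Fin n)).card := by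
    apply Finset.card_le_card_of_injOn (fun π (v : S) => π v.1) (fun _ _ => Finset.mem_univ _)
    intro π hπ τ hτ h
    simp only [permsOn, Finset.coe_filter, Finset.mem_univ, true_and, Set.mem_ofPred_eq] at hπ hτ
    ext v
    by_cases hv : v ∈ S
    · have := congrFun h ⟨v, hv⟩
      simp only at this
      rw [this]
    · rw [hπ v hv, hτ v hv]
  simpa using h

lemma map_inj {n : ℕ} (π : Equiv.Perm (Fin n)) :
    Function.Injective (Sym2.map (fun x => π x)) := Sym2.map.injective π.injective

set_option maxHeartbeats 1000000

/-- deterministic part -/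
lemma determ {n : ℕ} (E : Finset (Sym2 (Fin n))) (hE : E ⊆ UU n) (π : Equiv.Perm (Fin n))
    (S : Finset (Fin n)) (hS : ∀ v, v ∈ S ↔ π v ≠ v) (l' : ℕ)
    (h : ((E.filter fun e => Sym2.map (fun x => π x) e ∉ E).card) + S.card + 3 * l' ≤
      (E ∩ touch S).card + 2) :
    ∃ F ∈ ((touch S).powersetCard l').filter
        (fun F => Disjoint F (F.image (Sym2.map (fun x => π x)))),
      F ∪ F.image (Sym2.map (fun x => π x)) ⊆ E := by
  set σ := Sym2.map (fun x => π x) with hσ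
  set B := (E ∩ touch S).filter (fun e => σ e ≠ e ∧ σ e ∈ E) with hB
  have hsub : E ∩ touch S ⊆ B ∪ (E.filter fun e => σ e ∉ E) ∪ S.image (fun v => s(v, π v)) := by
    intro e he
    by_cases h1 : σ e ∈ E
    · by_cases h2 : σ e = e
      · apply Finset.mem_union_right
        obtain ⟨v, hv, hve⟩ := (Finset.mem_filter.1 (Finset.mem_inter.1 he).2).2
        obtain ⟨w, rfl⟩ := Sym2.mem_iff_exists.1 hve
        rw [hσ, Sym2.map_mk] at h2
        rw [Finset.mem_image]
        refine ⟨v, hv, ?_⟩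
        have hne := (hS v).1 hv
        rcases Sym2.eq_iff.1 h2 with h | h
        · exact absurd h.1 hne
        · rw [h.1]
      · apply Finset.mem_union_left
        apply Finset.mem_union_left
        exact Finset.mem_filter.2 ⟨he, h2, h1⟩
    · apply Finset.mem_union_left
      apply Finset.mem_union_right
      exact Finset.mem_filter.2 ⟨(Finset.mem_inter.1 he).1, h1⟩
  have hc := Finset.card_le_card hsub
  have h4 := Finset.card_union_le (B ∪ (E.filter fun e => σ e ∉ E)) (S.image (fun v => s(v, π v)))
  have h5 := Finset.card_union_le B (E.filter fun e => σ e ∉ E)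
  have h6 : (S.image (fun v => s(v, π v))).card ≤ S.card := Finset.card_image_le
  obtain ⟨F, hFB, hdis, hcard⟩ := extract σ (map_inj π) B
    (fun b hb => (Finset.mem_filter.1 hb).2.1)
  have hlF : l' ≤ F.card := by omega
  obtain ⟨F', hF', hF'c⟩ := Finset.exists_subset_card_eq hlF
  refine ⟨F', ?_, ?_⟩
  · rw [Finset.mem_filter, Finset.mem_powersetCard]
    refine ⟨⟨fun e he => (Finset.mem_inter.1 (Finset.mem_filter.1 (hFB (hF' he))).1).2, hF'c⟩, ?_⟩
    exact Disjoint.mono hF' (Finset.image_subset_image hF') hdis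
  · intro e he
    rcases Finset.mem_union.1 he with h | h
    · exact (Finset.mem_inter.1 (Finset.mem_filter.1 (hFB (hF' h))).1).1
    · obtain ⟨f, hf, rfl⟩ := Finset.mem_image.1 h
      exact (Finset.mem_filter.1 (hFB (hF' hf))).2.2

/-- The event that some structure on `S` fails. -/
def badS {n : ℕ} (L : ℝ) (l' : ℕ) (S : Finset (Fin n)) (E : Finset (Sym2 (Fin n))) : Prop :=
  ((E ∩ touch S).card : ℝ) ≤ L ∨
    ∃ q ∈ (permsOn S) ×ˢ ((touch S).powersetCard l'), 
      Disjoint q.2 (q.2.image (Sym2.map (fun x => q.1 x))) ∧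
        q.2 ∪ q.2.image (Sym2.map (fun x => q.1 x)) ⊆ E

lemma map_UU {n : ℕ} (π : Equiv.Perm (Fin n)) (e : Sym2 (Fin n)) (he : e ∈ UU n) :
    Sym2.map (fun x => π x) e ∈ UU n := by
  induction e using Sym2.ind with
  | _ a b => simpa [UU] using he

lemma MU_badS {n : ℕ} (p : ℝ) (hp0 : 0 ≤ p) (hp1 : p ≤ 1) (L : ℝ) (l' : ℕ)
    (S : Finset (Fin n)) :
    MU (UU n) p (badS L l' S) ≤ Real.exp (4 * L - 0.98 * (p * (touch S).card)) +
      (n:ℝ) ^ S.card * ((touch S).card.choose l' * p ^ (2 * l')) := by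
  unfold badS
  refine (MU_or _ p hp0 hp1 _ _).trans ?_
  refine add_le_add (MU_lower _ p hp0 hp1 _ (touch_subset S) L) ?_
  refine (MU_union _ p hp0 hp1 _ ((permsOn S) ×ˢ ((touch S).powersetCard l'))
    (fun q E => Disjoint q.2 (q.2.image (Sym2.map (fun x => q.1 x))) ∧
        q.2 ∪ q.2.image (Sym2.map (fun x => q.1 x)) ⊆ E) (fun E _ h => h)).trans ?_
  have hb : ∀ q ∈ (permsOn S) ×ˢ ((touch S).powersetCard l'),
      MU (UU n) p (fun E => Disjoint q.2 (q.2.image (Sym2.map (fun x => q.1 x))) ∧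
        q.2 ∪ q.2.image (Sym2.map (fun x => q.1 x)) ⊆ E) ≤ p ^ (2 * l') := by
    rintro ⟨π, F⟩ hq
    rw [Finset.mem_product, Finset.mem_powersetCard] at hq
    obtain ⟨_, hF, hFc⟩ := hq
    simp only at hF hFc ⊢
    by_cases hd : Disjoint F (F.image (Sym2.map (fun x => π x)))
    · simp only [hd, true_and]
      refine (MU_superset _ p _ ?_).trans ?_
      · intro e he
        rcases Finset.mem_union.1 he with h | h
        · exact touch_subset S (hF h)
        · obtain ⟨f, hf, rfl⟩ := Finset.mem_image.1 h
          exact map_UU π f (touch_subset S (hF hf))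
      · rw [Finset.card_union_of_disjoint hd, Finset.card_image_of_injective _ (map_inj π), hFc,
          two_mul]
    · simp only [hd, false_and, MU]
      simp only [Finset.filter_false, Finset.sum_empty]
      positivity
  refine (Finset.sum_le_sum hb).trans ?_
  rw [Finset.sum_const, Finset.card_product, Finset.card_powersetCard, nsmul_eq_mul]
  push_cast
  rw [mul_assoc]
  gcongr
  exact_mod_cast card_permsOn S

lemma bad_implies {n m : ℕ} (hn : 2 ≤ n) (c : ℝ) (hm : (m:ℝ) = c * n) (hc : 10 ^ 4 ≤ c)
    (E : Finset (Sym2 (Fin n))) (hE : E ⊆ UU n) (hEm : E.card = m)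
    (h : ¬ ∀ β : ℝ, max (Real.exp (-c / 6)) (1 / (n : ℝ)) ≤ β → β ≤ 1 →
            gAsymmetric E β (β / 240)) :
    ∃ k ∈ (Finset.Icc 2 n).filter (fun k : ℕ => n * Real.exp (-c / 6) ≤ k),
      ∃ S ∈ (Finset.univ : Finset (Fin n)).powersetCard k,
        badS (c * k / 100) ⌈0.0019 * (c * k)⌉₊ S E := by
  simp only [gAsymmetric, not_forall, not_lt] at h
  obtain ⟨β, hβ, hβ1, π, hfix, haut⟩ := h
  have hn' : (2:ℝ) ≤ n := by exact_mod_cast hn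
  have hn0 : (0:ℝ) < n := by linarith
  have hc0 : (0:ℝ) < c := by linarith
  have hm0 : (0:ℝ) < m := by rw [hm]; positivity
  set S : Finset (Fin n) := Finset.univ.filter (fun v => π v ≠ v) with hS
  have hSmem : ∀ v, v ∈ S ↔ π v ≠ v := by intro v; simp [hS]
  have hcard : fixedCount π + S.card = n := by
    have := Finset.card_filter_add_card_filter_not (s := (Finset.univ : Finset (Fin n))) (fun v => π v = v)
    simpa [fixedCount, hS] using this
  have hcard' : (fixedCount π : ℝ) + S.card = n := by exact_mod_cast hcard
  have hkβ : β * n ≤ S.card := by linarith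
  have h1 : Real.exp (-c/6) ≤ β := (le_max_left _ _).trans hβ
  have h2 : 1 / (n:ℝ) ≤ β := (le_max_right _ _).trans hβ
  have hk1 : (1:ℝ) ≤ S.card := by
    rw [div_le_iff₀ hn0] at h2; linarith
  have hk1' : 1 ≤ S.card := by exact_mod_cast hk1
  have hkne : S.card ≠ 1 := by
    have := Equiv.Perm.card_support_ne_one π
    convert this using 2
    ext v; simp [hS]
  have hk2 : 2 ≤ S.card := by omega
  have hk2' : (2:ℝ) ≤ S.card := by exact_mod_cast hk2
  refine ⟨S.card, ?_, S, ?_, ?_⟩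
  · rw [Finset.mem_filter, Finset.mem_Icc]
    refine ⟨⟨hk2, by omega⟩, ?_⟩
    nlinarith
  · simp [Finset.mem_powersetCard]
  · by_cases hL : ((E ∩ touch S).card : ℝ) ≤ c * S.card / 100
    · exact Or.inl hL
    · right
      have hX : ((E.filter fun e => Sym2.map (fun x => π x) e ∉ E).card : ℝ) ≤ c * S.card / 240 := by
        have hsum := Finset.card_filter_add_card_filter_not (s := E) (fun e => Sym2.map (fun x => π x) e ∈ E)
        have hsum' : ((E.filter fun e => Sym2.map (fun x => π x) e ∈ E).card : ℝ) +
          (E.filter fun e => Sym2.map (fun x => π x) e ∉ E).card = m := by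
            rw [← hEm]; exact_mod_cast hsum
        rw [gAut, hEm, le_div_iff₀ hm0] at haut
        have : m * β ≤ c * S.card := by rw [hm]; nlinarith
        linarith
      obtain ⟨F, hF, hFE⟩ := determ E hE π S hSmem ⌈0.0019 * (c * S.card)⌉₊ (by
        have hceil := (Nat.ceil_lt_add_one (a := 0.0019 * (c * (S.card:ℝ))) (by positivity))
        have hck : 10 ^ 4 * (S.card : ℝ) ≤ c * S.card := by gcongr
        rw [not_le] at hL
        have : ((E.filter fun e => Sym2.map (fun x => π x) e ∉ E).card : ℝ) + S.card +
          3 * (⌈0.0019 * (c * (S.card:ℝ))⌉₊ : ℝ) < ((E ∩ touch S).card : ℝ) + 2 + 1 := by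
            linarith
        have h' : (E.filter fun e => Sym2.map (fun x => π x) e ∉ E).card + S.card +
          3 * ⌈0.0019 * (c * (S.card:ℝ))⌉₊ < (E ∩ touch S).card + 2 + 1 := by exact_mod_cast this
        omega)
      rw [Finset.mem_filter] at hF
      refine ⟨(π, F), ?_, hF.2, hFE⟩
      rw [Finset.mem_product]
      refine ⟨?_, hF.1⟩
      simp only [permsOn, Finset.mem_filter, Finset.mem_univ, true_and]
      intro v hv
      by_contra hne
      exact hv ((hSmem v).2 hne)

/-- For all sufficiently large `n`: if `m = cn` with
`10⁴ ≤ c ≤ n/10¹⁰` and `β* = max{e^{−c/6}, 1/n}`, then with probability at least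
`1 − n⁻¹⁵` over `G ∼ G_{n,m}`, for every `β` with `β* ≤ β ≤ 1` the graph `G` is
`(β, β/240)`-asymmetric. -/
theorem random_graphs_robustly_asymmetric :
    ∃ n₀ : ℕ, ∀ n : ℕ, n₀ ≤ n → ∀ (c : ℝ) (m : ℕ),
      (m : ℝ) = c * n → 10 ^ 4 ≤ c → c ≤ (n : ℝ) / 10 ^ 10 →
      1 - 1 / (n : ℝ) ^ 15 ≤
        prob (graphSpace n m) (fun E => ∀ β : ℝ,
          max (Real.exp (-c / 6)) (1 / (n : ℝ)) ≤ β → β ≤ 1 →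
            gAsymmetric E β (β / 240)) := by
  have hev : ∀ᶠ n : ℕ in Filter.atTop, 200 ≤ Real.log n ∧
      13 * Real.log n ≤ 0.0019 * (n:ℝ) ^ (1/4:ℝ) ∧ 100 ≤ n := by
    have h1 := (Real.tendsto_log_atTop.comp tendsto_natCast_atTop_atTop).eventually_ge_atTop 200
    have h2 := ((isLittleO_log_rpow_atTop (r := 1/4) (by norm_num)).comp_tendsto
      tendsto_natCast_atTop_atTop).bound (show (0:ℝ) < 0.0001 by norm_num)
    filter_upwards [h1, h2, Filter.eventually_ge_atTop 100] with n h1 h2 h3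
    simp only [Function.comp] at h1 h2
    refine ⟨h1, ?_, h3⟩
    rw [Real.norm_of_nonneg (by linarith), Real.norm_of_nonneg (by positivity)] at h2
    have : (0:ℝ) ≤ (n:ℝ) ^ (1/4:ℝ) := by positivity
    linarith
  obtain ⟨n₀, hn₀⟩ := Filter.eventually_atTop.1 hev
  refine ⟨n₀, fun n hn c m hm hc hcn => ?_⟩
  obtain ⟨hl, hev, hn100⟩ := hn₀ n hn
  have hn' : (100:ℝ) ≤ n := by exact_mod_cast hn100
  have hn0 : (0:ℝ) < n := by linarith
  have hn1 : (0:ℝ) < n - 1 := by linarith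
  have hc0 : (0:ℝ) < c := by linarith
  set good : Finset (Sym2 (Fin n)) → Prop := fun E => ∀ β : ℝ,
          max (Real.exp (-c / 6)) (1 / (n : ℝ)) ≤ β → β ≤ 1 →
            gAsymmetric E β (β / 240) with hgood
  set U := UU n with hU
  have hN : (U.card : ℝ) = n * (n - 1) / 2 := by rw [hU, card_UU, Nat.cast_choose_two]
  set p : ℝ := 2 * c / (n - 1) with hp
  have hp0 : 0 < p := by positivity
  have hcn' : c * 10 ^ 10 ≤ n := by rwa [le_div_iff₀ (by norm_num)] at hcn
  have hp1 : p < 1 := by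
    rw [hp, div_lt_one hn1]; linarith
  have hpm : p * U.card = m := by
    rw [hN, hm, hp]; field_simp
  have hmN : m ≤ U.card := by
    have : (m:ℝ) ≤ U.card := by
      rw [← hpm]
      have : (0:ℝ) ≤ U.card := Nat.cast_nonneg _
      nlinarith
    exact_mod_cast this
  -- the per-`k` bound
  have hterm : ∀ k ∈ (Finset.Icc 2 n).filter (fun k : ℕ => n * Real.exp (-c / 6) ≤ k),
      MU U p (fun E => ∃ S ∈ (Finset.univ : Finset (Fin n)).powersetCard k,
        badS (c * k / 100) ⌈0.0019 * (c * k)⌉₊ S E) ≤ 2 * Real.exp (-19 * Real.log n) := by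
    intro k hk
    rw [Finset.mem_filter, Finset.mem_Icc] at hk
    obtain ⟨⟨hk2, hkn⟩, hkc⟩ := hk
    set Tk : ℝ := k * (2 * n - k - 1) / 2 with hTk
    refine (MU_union U p hp0.le hp1.le _ _ _ (fun E _ h => h)).trans ?_
    have hb : ∀ S ∈ (Finset.univ : Finset (Fin n)).powersetCard k,
        MU U p (badS (c * k / 100) ⌈0.0019 * (c * k)⌉₊ S) ≤
          2 * Real.exp (-19 * Real.log n) / n.choose k := by
      intro S hS
      have hSk := (Finset.mem_powersetCard.1 hS).2
      have hch : (0:ℝ) < n.choose k := by exact_mod_cast Nat.choose_pos hkn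
      refine (MU_badS p hp0.le hp1.le _ _ S).trans ?_
      have e1 := num1 n k c (by linarith) (by omega) hc hk2 hkn hkc
      have e2 := num2 n k (touch S).card ⌈0.0019 * (c * k)⌉₊ c p hl hev hn100 hc hcn hk2 hp
        (by rw [← hSk]; exact card_touch_le S) (Nat.le_ceil _)
      have e3 : p * (touch S).card = c * k * (2 * n - k - 1) / (n - 1) := by
        rw [card_touch, hSk, hp]; field_simp
      rw [le_div_iff₀ hch, e3, hSk]
      linarith
    refine (Finset.sum_le_sum hb).trans ?_
    rw [Finset.sum_const, Finset.card_powersetCard, Finset.card_univ, Fintype.card_fin, nsmul_eq_mul]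
    have hch : (0:ℝ) < n.choose k := by exact_mod_cast Nat.choose_pos hkn
    rw [mul_div_cancel₀ _ hch.ne']
  obtain ⟨bad, hbad⟩ : ∃ bad : Finset (Sym2 (Fin n)) → Prop, bad = fun E =>
    ∃ k ∈ (Finset.Icc 2 n).filter (fun k : ℕ => n * Real.exp (-c / 6) ≤ k),
      ∃ S ∈ (Finset.univ : Finset (Fin n)).powersetCard k,
        badS (c * k / 100) ⌈0.0019 * (c * k)⌉₊ S E := ⟨_, rfl⟩
  have hMU : MU U p bad ≤ n * (2 * Real.exp (-19 * Real.log n)) := by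
    rw [hbad]
    refine (MU_union U p hp0.le hp1.le _ _ _ (fun E _ h => h)).trans ?_
    refine (Finset.sum_le_sum hterm).trans ?_
    rw [Finset.sum_const, nsmul_eq_mul]
    gcongr
    refine (Finset.card_filter_le _ _).trans ?_
    rw [Nat.card_Icc]; omega
  have htr := transfer U m hmN p hp0 hp1 hpm bad
  have hCpos : (0:ℝ) < U.card.choose m := by exact_mod_cast Nat.choose_pos hmN
  rw [graphSpace_eq, prob, Finset.card_powersetCard, le_div_iff₀ hCpos]
  have hsplit := Finset.card_filter_add_card_filter_not (s := U.powersetCard m) good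
  rw [Finset.card_powersetCard] at hsplit
  have hsplit' : (((U.powersetCard m).filter good).card : ℝ) +
    ((U.powersetCard m).filter (fun E => ¬ good E)).card = U.card.choose m := by exact_mod_cast hsplit
  have hle : (((U.powersetCard m).filter (fun E => ¬ good E)).card : ℝ) ≤
      ((U.powersetCard m).filter bad).card := by
    have : ((U.powersetCard m).filter (fun E => ¬ good E)).card ≤
      ((U.powersetCard m).filter bad).card := by
        apply Finset.card_le_card
        intro E hE
        rw [Finset.mem_filter, Finset.mem_powersetCard] at hE ⊢
        exact ⟨hE.1, by rw [hbad]; exact bad_implies (by omega) c hm hc E hE.1.1 hE.1.2 hE.2⟩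
    exact_mod_cast this
  have hexp : Real.exp (-19 * Real.log n) = 1 / (n:ℝ) ^ 19 := by
    rw [neg_mul, Real.exp_neg, one_div]
    congr 1
    have : (19:ℝ) = (19:ℕ) := by norm_num
    rw [this, Real.exp_nat_mul, Real.exp_log hn0]
  have hfin : ((U.card : ℝ) + 1) * (n * (2 * Real.exp (-19 * Real.log n))) ≤ 1 / (n:ℝ) ^ 15 := by
    have : (U.card : ℝ) + 1 ≤ (n:ℝ)^2 := by rw [hN]; nlinarith
    rw [hexp]
    calc _ ≤ (n:ℝ)^2 * (n * (2 * (1 / (n:ℝ) ^ 19))) := by gcongr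
      _ = 2 / (n:ℝ)^16 := by field_simp
      _ ≤ _ := by
        rw [div_le_div_iff₀ (by positivity) (by positivity), pow_succ (n:ℝ) 15]
        have : (0:ℝ) < (n:ℝ)^15 := by positivity
        nlinarith
  have hfinal : (((U.powersetCard m).filter bad).card : ℝ) ≤ 1 / (n:ℝ)^15 * U.card.choose m := by
    calc _ ≤ _ := htr
      _ ≤ ((U.card : ℝ) + 1) * U.card.choose m * (n * (2 * Real.exp (-19 * Real.log n))) := by gcongr
      _ = ((U.card : ℝ) + 1) * (n * (2 * Real.exp (-19 * Real.log n))) * U.card.choose m := by ring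
      _ ≤ _ := by gcongr
  linarith

end Giso
end
end

section
/- Fix a constant c ≥ 10¹⁰ and let 𝒞 be a random 3XOR instance with n variables and m = cn equations. Then the probability that GI(G_𝒞, G_{homog(𝒞)}) ≥ 1 − 1/(95c²) tends to 0 as n → ∞; i.e., with probability 1 − o(1), GI(G_𝒞, G_{homog(𝒞)}) < 1 − 1/(95c²). -/
open scoped Classical

noncomputable section

namespace Giso

/-- The finset of edges of a simple graph on a finite vertex type. -/
def edges {V : Type*} [Fintype V] (G : SimpleGraph V) : Finset (Sym2 V) :=
  Finset.univ.filter fun e => e ∈ G.edgeSet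

/-- The fraction of edges of `G` carried to edges of `H` by the bijection `π`. -/
def GIval {V W : Type*} [Fintype V] [Fintype W] (G : SimpleGraph V) (H : SimpleGraph W)
    (π : V ≃ W) : ℝ :=
  (((edges G).filter fun e => Sym2.map (fun x => π x) e ∈ edges H).card : ℝ) /
    max ((edges G).card : ℝ) ((edges H).card : ℝ)

/-- `GI(G,H)`: the best fraction of preserved edges over all vertex bijections. -/
def GI {V W : Type*} [Fintype V] [Fintype W] (G : SimpleGraph V) (H : SimpleGraph W) : ℝ :=
  ⨆ π : V ≃ W, GIval G H π

/-- Sample space for a random 3XOR instance with `n` variables and `m` equations: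
a uniformly random set of `m` distinct variable triples, together with independent
uniform right-hand sides (recorded as a function on all triples; only its values on the
chosen triples matter, and counting all functions uniformly gives the correct
distribution). -/
def xorSpace (n m : ℕ) : Finset (Finset (Finset (Fin n)) × (Finset (Fin n) → ZMod 2)) :=
  Finset.univ.filter fun p => p.1.card = m ∧ ∀ e ∈ p.1, e.card = 3

/-- Vertices of the gadget graph of a set-presented 3XOR instance `(T, b)`:
variable vertices `x ↦ a` together with, for each triple `e ∈ T`, the four constraint
vertices given by the satisfying assignments of the equation `∑_{x ∈ e} x = b(e)`. -/
abbrev SVert (n : ℕ) (T : Finset (Finset (Fin n))) (b : Finset (Fin n) → ZMod 2) : Type :=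
  (Fin n × ZMod 2) ⊕
    (Σ e : {e // e ∈ T}, {α : {v // v ∈ e.1} → ZMod 2 // (∑ w : {v // v ∈ e.1}, α w) = b e.1})

/-- The gadget graph `G_𝒞` of the set-presented 3XOR instance `𝒞 = (T, b)`: each pair
`V_x` is joined by an edge, the constraint vertices of each equation form a clique, and
each constraint vertex is joined to the variable vertices it is consistent with. -/
def setGadget (n : ℕ) (T : Finset (Finset (Fin n))) (b : Finset (Fin n) → ZMod 2) :
    SimpleGraph (SVert n T b) :=
  SimpleGraph.fromRel fun u v =>
    (∃ (j : Fin n) (a a' : ZMod 2), u = Sum.inl (j, a) ∧ v = Sum.inl (j, a')) ∨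
    (∃ (e : {e // e ∈ T})
        (α α' : {α : {v // v ∈ e.1} → ZMod 2 // (∑ w : {v // v ∈ e.1}, α w) = b e.1}),
      u = Sum.inr ⟨e, α⟩ ∧ v = Sum.inr ⟨e, α'⟩) ∨
    (∃ (e : {e // e ∈ T})
        (α : {α : {v // v ∈ e.1} → ZMod 2 // (∑ w : {v // v ∈ e.1}, α w) = b e.1})
        (w : {v // v ∈ e.1}),
      u = Sum.inl (w.1, α.1 w) ∧ v = Sum.inr ⟨e, α⟩)

/-! ### Adjacency in the gadget graph -/

section Adj

variable {n : ℕ} {T : Finset (Finset (Fin n))} {b : Finset (Fin n) → ZMod 2}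

/-- Constraint vertices. -/
abbrev CVert (n : ℕ) (T : Finset (Finset (Fin n))) (b : Finset (Fin n) → ZMod 2) : Type :=
  (Σ e : {e // e ∈ T}, {α : {v // v ∈ e.1} → ZMod 2 // (∑ w : {v // v ∈ e.1}, α w) = b e.1})

/-- The assignment of a constraint vertex, extended by zero. -/
def cval (q : CVert n T b) : Fin n → ZMod 2 :=
  fun j => if h : j ∈ q.1.1 then q.2.1 ⟨j, h⟩ else 0

lemma cval_sum (q : CVert n T b) : ∑ j ∈ q.1.1, cval q j = b q.1.1 := by
  rw [← q.2.2, ← Finset.sum_coe_sort]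
  apply Finset.sum_congr rfl
  intro w _
  simp [cval]

lemma cval_ext {p q : CVert n T b} (h : p.1 = q.1)
    (h2 : ∀ j ∈ p.1.1, cval p j = cval q j) : p = q := by
  obtain ⟨e, α⟩ := p
  obtain ⟨e', β⟩ := q
  simp only at h
  subst h
  congr 1
  apply Subtype.ext
  funext w
  have := h2 w.1 w.2
  simpa [cval] using this

/-- Build a constraint vertex. -/
def cmk (e : {e // e ∈ T}) (a : Fin n → ZMod 2) (h : ∑ j ∈ e.1, a j = b e.1) : CVert n T b :=
  ⟨e, ⟨fun w => a w.1, by rw [← h]; exact Finset.sum_coe_sort e.1 a⟩⟩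

lemma cval_cmk (e : {e // e ∈ T}) (a : Fin n → ZMod 2) (h : ∑ j ∈ e.1, a j = b e.1)
    {j : Fin n} (hj : j ∈ e.1) : cval (cmk e a h) j = a j := by
  have : j ∈ (cmk e a h).1.1 := hj
  simp only [cval, this, dif_pos]
  rfl

lemma adj_ll {p q : Fin n × ZMod 2} :
    (setGadget n T b).Adj (Sum.inl p) (Sum.inl q) ↔ p.1 = q.1 ∧ p.2 ≠ q.2 := by
  obtain ⟨j, a⟩ := p
  obtain ⟨k, a'⟩ := q
  simp only [setGadget, SimpleGraph.fromRel_adj]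
  simp
  grind

lemma adj_rr {p q : CVert n T b} :
    (setGadget n T b).Adj (Sum.inr p) (Sum.inr q) ↔ p.1 = q.1 ∧ p ≠ q := by
  obtain ⟨e, α⟩ := p
  obtain ⟨e', β⟩ := q
  simp only [setGadget, SimpleGraph.fromRel_adj]
  constructor
  · rintro ⟨hne, h⟩
    refine ⟨?_, fun h => hne (by rw [h])⟩
    rcases h with (⟨_, _, _, h, _⟩ | ⟨f, x, y, h1, h2⟩ | ⟨_, _, _, h, _⟩) |
      (⟨_, _, _, h, _⟩ | ⟨f, x, y, h1, h2⟩ | ⟨_, _, _, h, _⟩)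
    · cases h
    · cases h1; cases h2; rfl
    · cases h
    · cases h
    · cases h1; cases h2; rfl
    · cases h
  · rintro ⟨h1, h2⟩
    have h1 : e = e' := h1
    subst h1
    exact ⟨fun h => h2 (Sum.inr.inj h), Or.inl (Or.inr (Or.inl ⟨_, _, _, rfl, rfl⟩))⟩

lemma adj_lr {p : Fin n × ZMod 2} {q : CVert n T b} :
    (setGadget n T b).Adj (Sum.inl p) (Sum.inr q) ↔ p.1 ∈ q.1.1 ∧ cval q p.1 = p.2 := by
  obtain ⟨e, β⟩ := q
  obtain ⟨j, a⟩ := p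
  simp only [setGadget, SimpleGraph.fromRel_adj]
  constructor
  · rintro ⟨-, h⟩
    rcases h with (⟨_, _, _, _, h⟩ | ⟨f, x, y, h1, h2⟩ | ⟨f, x, w, h1, h2⟩) |
      (⟨_, _, _, h, _⟩ | ⟨f, x, y, h1, h2⟩ | ⟨_, _, _, h, _⟩)
    · cases h
    · cases h1
    · cases h1
      cases h2
      refine ⟨w.2, ?_⟩
      simp [cval]
    · cases h
    · cases h2
    · cases h
  · rintro ⟨h1, h2⟩
    simp only [cval, h1, dif_pos] at h2
    refine ⟨Sum.inl_ne_inr, Or.inl (Or.inr (Or.inr ⟨e, β, ⟨j, h1⟩, ?_, rfl⟩))⟩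
    rw [h2]

/-- Two coordinates determine a constraint vertex. -/
lemma two_coord {p q : CVert n T b} (h : p.1 = q.1) (h3 : p.1.1.card = 3) {j k : Fin n}
    (hj : j ∈ p.1.1) (hk : k ∈ p.1.1) (hjk : j ≠ k) (e1 : cval p j = cval q j)
    (e2 : cval p k = cval q k) : p = q := by
  apply cval_ext h
  have hp := cval_sum p
  have hq := cval_sum q
  rw [← h] at hq
  have hs : ∑ i ∈ p.1.1, (cval p i - cval q i) = 0 := by
    rw [Finset.sum_sub_distrib, hp, hq, sub_self]
  intro l hl
  by_cases hlj : l = j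
  · rw [hlj, e1]
  by_cases hlk : l = k
  · rw [hlk, e2]
  have hz : ∑ i ∈ p.1.1, (cval p i - cval q i) = cval p l - cval q l := by
    apply Finset.sum_eq_single_of_mem l hl
    intro i hi hil
    have : p.1.1 = {j, k, l} := by
      symm
      apply Finset.eq_of_subset_of_card_le
      · intro t; simp; rintro (rfl | rfl | rfl) <;> assumption
      · rw [h3, Finset.card_eq_three.mpr ⟨j, k, l, hjk, fun h => hlj h.symm, fun h => hlk h.symm, rfl⟩]
    rw [this] at hi
    simp at hi
    rcases hi with rfl | rfl | rfl
    · rw [e1, sub_self]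
    · rw [e2, sub_self]
    · exact absurd rfl hil
  rw [hz] at hs
  exact sub_eq_zero.mp hs

lemma z2_three (a b c : ZMod 2) (h1 : a ≠ b) (h2 : a ≠ c) : b = c := by
  revert a b c; decide

lemma z2_succ (a b : ZMod 2) (h : a ≠ b) : b = a + 1 := by
  revert a b; decide

/-- No vertex of a 4-clique is a variable vertex. -/
lemma no_inl (hT : ∀ e ∈ T, e.card = 3) {u v w t : SVert n T b}
    (uv : (setGadget n T b).Adj u v) (uw : (setGadget n T b).Adj u w)
    (ut : (setGadget n T b).Adj u t) (vw : (setGadget n T b).Adj v w)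
    (vt : (setGadget n T b).Adj v t) (wt : (setGadget n T b).Adj w t) :
    ∃ q, u = Sum.inr q := by
  have L1 : ∀ (p q : Fin n × ZMod 2) (w : SVert n T b),
      (setGadget n T b).Adj (Sum.inl p) (Sum.inl q) →
      (setGadget n T b).Adj (Sum.inl p) w → (setGadget n T b).Adj (Sum.inl q) w → False := by
    intro p q w h1 h2 h3
    rw [adj_ll] at h1
    rcases w with w | w
    · rw [adj_ll] at h2 h3
      exact h3.2 (z2_three _ _ _ h1.2 h2.2)
    · rw [adj_lr] at h2 h3
      rw [h1.1] at h2
      exact h1.2 (h2.2.symm.trans h3.2)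
  rcases u with p | q
  · exfalso
    rcases v with v | v
    · exact L1 _ _ _ uv uw vw
    rcases w with w | w
    · exact L1 _ _ _ uw ut wt
    rcases t with t | t
    · exact L1 _ _ _ ut uv vt.symm
    rw [adj_lr] at uv uw ut
    rw [adj_rr] at vw vt wt
    have h3 : v.1.1.card = 3 := hT _ v.1.2
    obtain ⟨k, hk, hkp⟩ : ∃ k ∈ v.1.1, k ≠ p.1 := by
      apply Finset.exists_mem_ne; omega
    have hkw : k ∈ w.1.1 := by rw [← vw.1]; exact hk
    have a1 : cval v k ≠ cval w k := fun h =>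
      vw.2 (two_coord vw.1 h3 hk uv.1 hkp h (uv.2.trans uw.2.symm))
    have a2 : cval v k ≠ cval t k := fun h =>
      vt.2 (two_coord vt.1 h3 hk uv.1 hkp h (uv.2.trans ut.2.symm))
    exact wt.2 (two_coord wt.1 (hT _ w.1.2) hkw uw.1 hkp (z2_three _ _ _ a1 a2)
      (uw.2.trans ut.2.symm))
  · exact ⟨q, rfl⟩

/-- There are at most four constraint vertices for each equation. -/
lemma five (hT : ∀ e ∈ T, e.card = 3) (q : Fin 5 → CVert n T b) (hq : Function.Injective q)
    (h : ∀ i, (q i).1 = (q 0).1) : False := by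
  have h3 : (q 0).1.1.card = 3 := hT _ (q 0).1.2
  obtain ⟨x, y, z, hxy, -, -, he⟩ := Finset.card_eq_three.mp h3
  have hx : x ∈ (q 0).1.1 := by rw [he]; simp
  have hy : y ∈ (q 0).1.1 := by rw [he]; simp
  have hinj : Function.Injective (fun i : Fin 5 => (cval (q i) x, cval (q i) y)) := by
    intro i j hij
    simp only [Prod.mk.injEq] at hij
    apply hq
    refine two_coord ((h i).trans (h j).symm) (hT _ (q i).1.2) (j := x) (k := y) ?_ ?_ hxy hij.1 hij.2
    · rw [h i]; exact hx
    · rw [h i]; exact hy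
  have := Fintype.card_le_of_injective _ hinj
  simp at this

/-- The image of a variable vertex of a preserved equation is a variable vertex. -/
lemma img_inl (hT : ∀ e ∈ T, e.card = 3) {u0 u1 v0 v1 : CVert n T b}
    (huu : u0 ≠ u1) (h00 : u0 ≠ v0) (h01 : u0 ≠ v1) (h10 : u1 ≠ v0) (h11 : u1 ≠ v1)
    (hvv : v0 ≠ v1) (e1 : u1.1 = u0.1) (e2 : v0.1 = u0.1) (e3 : v1.1 = u0.1)
    {p : SVert n T b} (k0 : (setGadget n T b).Adj p (Sum.inr u0))
    (k1 : (setGadget n T b).Adj p (Sum.inr u1)) (n0 : p ≠ Sum.inr v0) (n1 : p ≠ Sum.inr v1) :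
    ∃ r, p = Sum.inl r := by
  rcases p with r | q
  · exact ⟨r, rfl⟩
  · exfalso
    rw [adj_rr] at k0 k1
    have n0' : q ≠ v0 := fun h => n0 (by rw [h])
    have n1' : q ≠ v1 := fun h => n1 (by rw [h])
    apply five hT ![q, u0, u1, v0, v1]
    · intro i j hij
      fin_cases i <;> fin_cases j <;> simp at hij ⊢ <;> grind
    · intro i
      fin_cases i <;> simp <;> grind

lemma step3 (hT : ∀ e ∈ T, e.card = 3) {u0 u1 v0 v1 : CVert n T b}
    (huu : u0 ≠ u1) (h00 : u0 ≠ v0) (h01 : u0 ≠ v1) (h10 : u1 ≠ v0) (h11 : u1 ≠ v1)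
    (hvv : v0 ≠ v1) (e1 : u1.1 = u0.1) (e2 : v0.1 = u0.1) (e3 : v1.1 = u0.1)
    {p p' : SVert n T b}
    (k0 : (setGadget n T b).Adj p (Sum.inr u0))
    (k1 : (setGadget n T b).Adj p (Sum.inr u1)) (n0 : p ≠ Sum.inr v0) (n1 : p ≠ Sum.inr v1)
    (k0' : (setGadget n T b).Adj p' (Sum.inr v0))
    (k1' : (setGadget n T b).Adj p' (Sum.inr v1)) (n0' : p' ≠ Sum.inr u0)
    (n1' : p' ≠ Sum.inr u1) (hpp : p ≠ p') :
    ∃ f ∈ u0.1.1, ∃ t, p = Sum.inl (f, t) ∧ cval u0 f = t ∧ cval u1 f = t ∧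
      cval v0 f = t + 1 ∧ cval v1 f = t + 1 := by
  obtain ⟨⟨f, t⟩, rfl⟩ := img_inl hT huu h00 h01 h10 h11 hvv e1 e2 e3 k0 k1 n0 n1
  obtain ⟨⟨f', t'⟩, rfl⟩ := img_inl hT hvv h00.symm h10.symm h01.symm h11.symm huu
    (e3.trans e2.symm) e2.symm (e1.trans e2.symm) k0' k1' n0' n1'
  rw [adj_lr] at k0 k1 k0' k1'
  simp only at k0 k1 k0' k1'
  by_cases hff : f = f'
  · subst hff
    have htt : t ≠ t' := fun h => hpp (by rw [h])
    have : t' = t + 1 := z2_succ _ _ htt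
    subst this
    exact ⟨f, k0.1, t, rfl, k0.2, k1.2, k0'.2, k1'.2⟩
  · exfalso
    have c0 : u0.1.1.card = 3 := hT _ u0.1.2
    have c1 : u1.1.1.card = 3 := hT _ u1.1.2
    have c2 : v0.1.1.card = 3 := hT _ v0.1.2
    have f0 : f' ∈ u0.1.1 := by rw [← e2]; exact k0'.1
    have f1 : f' ∈ u1.1.1 := by rw [e1]; exact f0
    have g0 : f ∈ v0.1.1 := by rw [e2]; exact k0.1
    have ha : cval u0 f' ≠ cval u1 f' := fun h =>
      huu (two_coord e1.symm c0 k0.1 f0 hff (k0.2.trans k1.2.symm) h)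
    have hb : cval v0 f ≠ cval v1 f := fun h =>
      hvv (two_coord (e2.trans e3.symm) c2 g0 k0'.1 hff h (k0'.2.trans k1'.2.symm))
    have ha' : cval u0 f' = t' ∨ cval u1 f' = t' := by
      by_contra hc
      push Not at hc
      exact ha (z2_three _ _ _ hc.1.symm hc.2.symm)
    have hb' : cval v0 f = t ∨ cval v1 f = t := by
      by_contra hc
      push Not at hc
      exact hb (z2_three _ _ _ hc.1.symm hc.2.symm)
    rcases ha' with ha' | ha' <;> rcases hb' with hb' | hb'
    · exact h00 (two_coord e2.symm c0 k0.1 f0 hff (k0.2.trans hb'.symm) (ha'.trans k0'.2.symm))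
    · exact h01 (two_coord e3.symm c0 k0.1 f0 hff (k0.2.trans hb'.symm) (ha'.trans k1'.2.symm))
    · exact h10 (two_coord (e1.trans e2.symm) c1 k1.1 f1 hff (k1.2.trans hb'.symm)
        (ha'.trans k0'.2.symm))
    · exact h11 (two_coord (e1.trans e3.symm) c1 k1.1 f1 hff (k1.2.trans hb'.symm)
        (ha'.trans k1'.2.symm))

end Adj

/-! ### Decoding an assignment from a bijection -/

section Decode

variable {n : ℕ} {T : Finset (Finset (Fin n))} {b : Finset (Fin n) → ZMod 2}

/-- The assignment decoded from a bijection. -/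
def sgn (π : SVert n T b ≃ SVert n T (fun _ => 0)) (j : Fin n) : ZMod 2 :=
  Sum.elim (fun r => r.2) (fun _ => 0) (π (Sum.inl (j, 0)))

lemma sgn_eq (π : SVert n T b ≃ SVert n T (fun _ => 0)) {j f : Fin n} {t : ZMod 2}
    (h : π (Sum.inl (j, 0)) = Sum.inl (f, t)) : sgn π j = t :=
  congrArg (Sum.elim (fun r : Fin n × ZMod 2 => r.2) (fun _ => 0)) h

lemma key (hT : ∀ e ∈ T, e.card = 3) (π : SVert n T b ≃ SVert n T (fun _ => 0))
    (e : {e // e ∈ T})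
    (pres : ∀ q : CVert n T b, q.1 = e → ∀ v, (setGadget n T b).Adj (Sum.inr q) v →
      (setGadget n T (fun _ => 0)).Adj (π (Sum.inr q)) (π v)) :
    ∑ j ∈ e.1, sgn π j = b e.1 := by
  obtain ⟨x, y, z, hxy, hxz, hyz, he⟩ := Finset.card_eq_three.mp (hT _ e.2)
  have sum3 : ∀ g : Fin n → ZMod 2, ∑ j ∈ e.1, g j = g x + (g y + g z) := by
    intro g
    rw [he, Finset.sum_insert (by simp [hxy, hxz]), Finset.sum_insert (by simp [hyz]),
      Finset.sum_singleton]
  have hx : x ∈ e.1 := by rw [he]; simp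
  have hy : y ∈ e.1 := by rw [he]; simp
  have hz : z ∈ e.1 := by rw [he]; simp
  have d0 : ∀ i j β : ZMod 2, i + (j + (β + i + j)) = β := by decide
  have d1 : ∀ β : ZMod 2, β ≠ β + 1 := by decide
  have d2 : ∀ β : ZMod 2, β + 0 + β = 0 := by decide
  have d3 : ∀ β : ZMod 2, β + 1 + (β + 1) = 0 := by decide
  have d4 : ∀ β : ZMod 2, β + 0 + (β + 1) = 1 := by decide
  have d5 : ∀ β : ZMod 2, β + 1 + β = 1 := by decide
  have d6 : ∀ β : ZMod 2, β = 0 ∨ β = 1 := by decide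
  obtain ⟨β, hβ⟩ : ∃ β, b e.1 = β := ⟨_, rfl⟩
  let a : ZMod 2 → ZMod 2 → Fin n → ZMod 2 := fun i j w =>
    if w = x then i else if w = y then j else β + i + j
  have ha : ∀ i j, ∑ w ∈ e.1, a i j w = b e.1 := by
    intro i j
    rw [sum3, hβ]
    simp only [a, if_true, hxy.symm, hxz.symm, hyz.symm, if_false]
    exact d0 i j β
  let q : ZMod 2 → ZMod 2 → CVert n T b := fun i j => cmk e (a i j) (ha i j)
  have qe : ∀ i j, (q i j).1 = e := fun i j => rfl
  have qx : ∀ i j, cval (q i j) x = i := by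
    intro i j
    rw [cval_cmk _ _ _ hx]; simp [a]
  have qy : ∀ i j, cval (q i j) y = j := by
    intro i j
    rw [cval_cmk _ _ _ hy]; simp [a, hxy.symm]
  have qz : ∀ i j, cval (q i j) z = β + i + j := by
    intro i j
    rw [cval_cmk _ _ _ hz]; simp [a, hxz.symm, hyz.symm]
  have qne : ∀ i j i' j', (i ≠ i' ∨ j ≠ j') → q i j ≠ q i' j' := by
    rintro i j i' j' h heq
    have h1 := qx i j
    have h2 := qy i j
    rw [heq, qx] at h1
    rw [heq, qy] at h2
    rcases h with h | h
    · exact h h1.symm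
    · exact h h2.symm
  have cl : ∀ i j i' j', (i ≠ i' ∨ j ≠ j') →
      (setGadget n T (fun _ => 0)).Adj (π (Sum.inr (q i j))) (π (Sum.inr (q i' j'))) := by
    intro i j i' j' h
    exact pres _ (qe i j) _ (adj_rr.mpr ⟨rfl, qne _ _ _ _ h⟩)
  have hinr : ∀ i j, ∃ r : CVert n T (fun _ => 0), π (Sum.inr (q i j)) = Sum.inr r := by
    intro i j
    have h1 : ∀ i : ZMod 2, i ≠ i + 1 := by decide
    have h2 : ∀ i : ZMod 2, i + 1 ≠ i := by decide
    exact no_inl hT (cl i j (i + 1) j (Or.inl (h1 _))) (cl i j i (j + 1) (Or.inr (h1 _)))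
      (cl i j (i + 1) (j + 1) (Or.inl (h1 _))) (cl _ _ _ _ (Or.inl (h2 _)))
      (cl _ _ _ _ (Or.inr (h1 _))) (cl _ _ _ _ (Or.inl (h1 _)))
  choose P hP using hinr
  have Pne : ∀ i j i' j', (i ≠ i' ∨ j ≠ j') → P i j ≠ P i' j' := by
    intro i j i' j' h heq
    have := cl i j i' j' h
    rw [hP, hP, heq] at this
    exact this.ne rfl
  have Pe : ∀ i j i' j', (P i j).1 = (P i' j').1 := by
    intro i j i' j'
    by_cases h : i = i' ∧ j = j'
    · rw [h.1, h.2]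
    · have := cl i j i' j' (by tauto)
      rw [hP, hP, adj_rr] at this
      exact this.1
  have vadj : ∀ w ∈ e.1, ∀ i j, ∀ v, cval (q i j) w = v →
      (setGadget n T (fun _ => 0)).Adj (π (Sum.inl (w, v))) (Sum.inr (P i j)) := by
    intro w hw i j v hv
    rw [← hP]
    refine (pres _ (qe i j) _ ?_).symm
    exact (adj_lr.mpr ⟨hw, hv⟩).symm
  have vne : ∀ w v i j, π (Sum.inl (w, v)) ≠ Sum.inr (P i j) := by
    intro w v i j h
    rw [← hP] at h
    exact Sum.inl_ne_inr (π.injective h)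
  have ppne : ∀ w : Fin n, π (Sum.inl (w, 0)) ≠ π (Sum.inl (w, 1)) := by
    intro w h
    have := Sum.inl.inj (π.injective h)
    simp at this
  have b1 : β ≠ β + 1 := d1 β
  have z1 : (0 : ZMod 2) ≠ 1 := by decide
  have z2 : (1 : ZMod 2) ≠ 0 := by decide
  obtain ⟨fx, mx, tx, px, x1, x2, x3, x4⟩ := step3 hT
    (Pne 0 0 0 1 (Or.inr z1)) (Pne 0 0 1 0 (Or.inl z1)) (Pne 0 0 1 1 (Or.inl z1))
    (Pne 0 1 1 0 (Or.inl z1)) (Pne 0 1 1 1 (Or.inl z1)) (Pne 1 0 1 1 (Or.inr z1))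
    (Pe _ _ _ _) (Pe _ _ _ _) (Pe _ _ _ _)
    (vadj x hx 0 0 0 (qx _ _)) (vadj x hx 0 1 0 (qx _ _)) (vne _ _ _ _) (vne _ _ _ _)
    (vadj x hx 1 0 1 (qx _ _)) (vadj x hx 1 1 1 (qx _ _)) (vne _ _ _ _) (vne _ _ _ _) (ppne x)
  obtain ⟨fy, my, ty, py, y1, y2, y3, y4⟩ := step3 hT
    (Pne 0 0 1 0 (Or.inl z1)) (Pne 0 0 0 1 (Or.inr z1)) (Pne 0 0 1 1 (Or.inl z1))
    (Pne 1 0 0 1 (Or.inl z2)) (Pne 1 0 1 1 (Or.inr z1)) (Pne 0 1 1 1 (Or.inl z1))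
    (Pe _ _ _ _) (Pe _ _ _ _) (Pe _ _ _ _)
    (vadj y hy 0 0 0 (qy _ _)) (vadj y hy 1 0 0 (qy _ _)) (vne _ _ _ _) (vne _ _ _ _)
    (vadj y hy 0 1 1 (qy _ _)) (vadj y hy 1 1 1 (qy _ _)) (vne _ _ _ _) (vne _ _ _ _) (ppne y)
  obtain ⟨fz, mz, tz, pz, w1, w2, w3, w4⟩ := step3 hT
    (Pne 0 β 1 (β + 1) (Or.inl z1)) (Pne 0 β 0 (β + 1) (Or.inr b1)) (Pne 0 β 1 β (Or.inl z1))
    (Pne 1 (β + 1) 0 (β + 1) (Or.inl z2)) (Pne 1 (β + 1) 1 β (Or.inr b1.symm))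
    (Pne 0 (β + 1) 1 β (Or.inl z1))
    (Pe _ _ _ _) (Pe _ _ _ _) (Pe _ _ _ _)
    (vadj z hz 0 β 0 ((qz _ _).trans (d2 β)))
    (vadj z hz 1 (β + 1) 0 ((qz _ _).trans (d3 β))) (vne _ _ _ _) (vne _ _ _ _)
    (vadj z hz 0 (β + 1) 1 ((qz _ _).trans (d4 β)))
    (vadj z hz 1 β 1 ((qz _ _).trans (d5 β)))
    (vne _ _ _ _) (vne _ _ _ _) (ppne z)
  rw [Pe 0 β 0 0] at mz
  have tt : ∀ t : ZMod 2, t ≠ t + 1 := by decide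
  have nxy : fx ≠ fy := by
    rintro rfl
    rw [x1] at y1
    rw [x2] at y3
    rw [y1] at y3
    exact tt _ y3
  have z00 : cval (T := T) (b := fun _ => 0) (P 0 0) fz = tz + β := by
    have hcase : β = 0 ∨ β = 1 := d6 β
    clear_value a q
    rcases hcase with rfl | rfl
    · rw [w1]; simp
    · simpa [show (1 : ZMod 2) + 1 = 0 from rfl] using w3
  have z01 : cval (T := T) (b := fun _ => 0) (P 0 1) fz = tz + β + 1 := by
    have hcase : β = 0 ∨ β = 1 := d6 β
    clear_value a q
    rcases hcase with rfl | rfl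
    · simpa using w3
    · rw [w1, add_assoc, show (1 : ZMod 2) + 1 = 0 from rfl, add_zero]
  have z10 : cval (T := T) (b := fun _ => 0) (P 1 0) fz = tz + β + 1 := by
    have hcase : β = 0 ∨ β = 1 := d6 β
    clear_value a q
    rcases hcase with rfl | rfl
    · simpa using w4
    · rw [add_assoc, show (1 : ZMod 2) + 1 = 0 from rfl, add_zero]
      simpa [show (1 : ZMod 2) + 1 = 0 from rfl] using w2
  have nxz : fx ≠ fz := by
    rintro rfl
    rw [x1] at z00
    rw [x2, z00] at z01
    exact tt _ z01
  have nyz : fy ≠ fz := by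
    rintro rfl
    rw [y1] at z00
    rw [y2, z00] at z10
    exact tt _ z10
  have hs := cval_sum (T := T) (b := fun _ => 0) (P 0 0)
  have he' : (P 0 0).1.1 = {fx, fy, fz} := by
    symm
    apply Finset.eq_of_subset_of_card_le
    · intro t; simp only [Finset.mem_insert, Finset.mem_singleton]
      rintro (rfl | rfl | rfl) <;> assumption
    · rw [hT _ (P 0 0).1.2, Finset.card_eq_three.mpr ⟨fx, fy, fz, nxy, nxz, nyz, rfl⟩]
  rw [he', Finset.sum_insert (by simp [nxy, nxz]), Finset.sum_insert (by simp [nyz]),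
      Finset.sum_singleton, x1, y1, z00] at hs
  rw [sum3, hβ, sgn_eq π px, sgn_eq π py, sgn_eq π pz]
  clear_value a q
  clear * - hs
  revert tx ty tz β
  decide

lemma mem_edges {V : Type*} [Fintype V] (G : SimpleGraph V) (u v : V) :
    s(u, v) ∈ edges G ↔ G.Adj u v := by
  simp [edges]

/-- A bijection losing few edges yields an assignment violating few equations. -/
lemma viol_le (hT : ∀ e ∈ T, e.card = 3) (π : SVert n T b ≃ SVert n T (fun _ => 0)) :
    (T.filter fun e => ∑ j ∈ e, sgn π j ≠ b e).card ≤
      ((edges (setGadget n T b)).filter fun e =>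
        ¬ Sym2.map (fun x => π x) e ∈ edges (setGadget n T (fun _ => 0))).card := by
  have h : ∀ e ∈ T.filter (fun e => ∑ j ∈ e, sgn π j ≠ b e),
      ∃ (q : CVert n T b) (v : SVert n T b), q.1.1 = e ∧
        (setGadget n T b).Adj (Sum.inr q) v ∧
        ¬ (setGadget n T (fun _ => 0)).Adj (π (Sum.inr q)) (π v) := by
    intro e he
    rw [Finset.mem_filter] at he
    by_contra hc
    push Not at hc
    exact he.2 (key hT π ⟨e, he.1⟩ fun q hq v hv => hc q v (by rw [hq]) hv)
  apply Finset.card_le_card_of_forall_subsingleton (fun e ed =>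
    ∃ (q : CVert n T b) (v : SVert n T b), q.1.1 = e ∧ ed = s(Sum.inr q, v))
  · intro e he
    obtain ⟨q, v, h1, h2, h3⟩ := h e he
    refine ⟨s(Sum.inr q, v), ?_, q, v, h1, rfl⟩
    rw [Finset.mem_filter, Sym2.map_mk, mem_edges, mem_edges]
    exact ⟨h2, h3⟩
  · rintro ed hed e ⟨-, q, v, rfl, rfl⟩ e' ⟨-, q', v', rfl, heq⟩
    rw [Finset.mem_filter, mem_edges] at hed
    rw [Sym2.eq_iff] at heq
    rcases heq with ⟨h, -⟩ | ⟨-, h⟩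
    · rw [Sum.inr.inj h]
    · have := hed.1
      rw [h, adj_rr] at this
      rw [this.1]

lemma edges_card (hT : ∀ e ∈ T, e.card = 3) :
    (edges (setGadget n T b)).card ≤ 4 * n + 88 * T.card := by
  let A : {e // e ∈ T} → Type := fun e =>
    {α : {v // v ∈ e.1} → ZMod 2 // (∑ w : {v // v ∈ e.1}, α w) = b e.1}
  have hA : ∀ e, Fintype.card (A e) ≤ 8 := by
    intro e
    refine (Fintype.card_subtype_le _).trans ?_
    rw [Fintype.card_fun, Fintype.card_coe, hT _ e.2, ZMod.card]
    norm_num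
  let F : (Fin n × ZMod 2 × ZMod 2) ⊕ ((Σ e, A e × A e) ⊕ (Σ e, A e × {v // v ∈ e.1})) →
      Sym2 (SVert n T b) := fun i => match i with
    | Sum.inl r => s(Sum.inl (r.1, r.2.1), Sum.inl (r.1, r.2.2))
    | Sum.inr (Sum.inl r) => s(Sum.inr ⟨r.1, r.2.1⟩, Sum.inr ⟨r.1, r.2.2⟩)
    | Sum.inr (Sum.inr r) => s(Sum.inl (r.2.2.1, r.2.1.1 r.2.2), Sum.inr ⟨r.1, r.2.1⟩)
  have hsub : edges (setGadget n T b) ⊆ Finset.univ.image F := by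
    intro s hs
    induction s using Sym2.ind with
    | _ u v =>
      rw [mem_edges, setGadget, SimpleGraph.fromRel_adj] at hs
      rw [Finset.mem_image]
      rcases hs with ⟨-, (⟨j, a, a', rfl, rfl⟩ | ⟨e, α, α', rfl, rfl⟩ | ⟨e, α, w, rfl, rfl⟩) |
        (⟨j, a, a', rfl, rfl⟩ | ⟨e, α, α', rfl, rfl⟩ | ⟨e, α, w, rfl, rfl⟩)⟩
      · exact ⟨Sum.inl (j, a, a'), Finset.mem_univ _, rfl⟩
      · exact ⟨Sum.inr (Sum.inl ⟨e, α, α'⟩), Finset.mem_univ _, rfl⟩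
      · exact ⟨Sum.inr (Sum.inr ⟨e, α, w⟩), Finset.mem_univ _, rfl⟩
      · exact ⟨Sum.inl (j, a, a'), Finset.mem_univ _, Sym2.eq_swap⟩
      · exact ⟨Sum.inr (Sum.inl ⟨e, α, α'⟩), Finset.mem_univ _, Sym2.eq_swap⟩
      · exact ⟨Sum.inr (Sum.inr ⟨e, α, w⟩), Finset.mem_univ _, Sym2.eq_swap⟩
  refine (Finset.card_le_card hsub).trans (Finset.card_image_le.trans ?_)
  rw [Finset.card_univ, Fintype.card_sum, Fintype.card_sum, Fintype.card_sigma, Fintype.card_sigma]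
  have c1 : Fintype.card (Fin n × ZMod 2 × ZMod 2) = 4 * n := by
    simp; ring
  have c2 : ∑ e, Fintype.card (A e × A e) ≤ 64 * T.card := by
    calc ∑ e, Fintype.card (A e × A e) ≤ ∑ e : {e // e ∈ T}, 64 := by
          apply Finset.sum_le_sum
          intro e _
          rw [Fintype.card_prod]
          have := hA e
          nlinarith
      _ = 64 * T.card := by simp [mul_comm]
  have c3 : ∑ e : {e // e ∈ T}, Fintype.card (A e × {v // v ∈ e.1}) ≤ 24 * T.card := by
    calc ∑ e : {e // e ∈ T}, Fintype.card (A e × {v // v ∈ e.1}) ≤ ∑ e : {e // e ∈ T}, 24 := by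
          apply Finset.sum_le_sum
          intro e _
          rw [Fintype.card_prod, Fintype.card_coe, hT _ e.2]
          have := hA e
          omega
      _ = 24 * T.card := by simp [mul_comm]
  omega

end Decode

/-- Large `GI` yields an assignment violating at most `n` equations. -/
lemma exists_assignment (c : ℝ) (hc : 10 ^ 10 ≤ c) {n : ℕ} {T : Finset (Finset (Fin n))}
    {b : Finset (Fin n) → ZMod 2} (hT : ∀ e ∈ T, e.card = 3) (hm : (T.card : ℝ) = c * n)
    (h : 1 - 1 / (95 * c ^ 2) ≤ GI (setGadget n T b) (setGadget n T fun _ => 0)) :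
    ∃ s : Fin n → ZMod 2, (T.filter fun e => ∑ j ∈ e, s j ≠ b e).card ≤ n := by
  have hc1 : (1 : ℝ) ≤ c := le_trans (by norm_num) hc
  have hε : 1 / (95 * c ^ 2) < 1 := by
    rw [div_lt_one (by positivity)]
    nlinarith
  have hne : Nonempty (SVert n T b ≃ SVert n T (fun _ => 0)) := by
    by_contra hne
    rw [not_nonempty_iff] at hne
    rw [GI, Real.iSup_of_isEmpty] at h
    linarith
  obtain ⟨π, hπ⟩ := exists_eq_ciSup_of_finite
    (f := fun π => GIval (setGadget n T b) (setGadget n T fun _ => 0) π)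
  rw [GI, ← hπ] at h
  refine ⟨sgn π, ?_⟩
  have hv := viol_le hT π
  have hG := edges_card (b := b) hT
  have hH := edges_card (b := fun _ => 0) hT
  simp only [GIval] at h
  have hsplit := Finset.card_filter_add_card_filter_not (s := edges (setGadget n T b))
    (fun e => Sym2.map (fun x => π x) e ∈ edges (setGadget n T (fun _ => 0)))
  set L := ((edges (setGadget n T b)).filter fun e =>
        ¬ Sym2.map (fun x => π x) e ∈ edges (setGadget n T (fun _ => 0))).card
  set K := ((edges (setGadget n T b)).filter fun e =>
        Sym2.map (fun x => π x) e ∈ edges (setGadget n T (fun _ => 0))).card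
  have h : 1 - 1 / (95 * c ^ 2) ≤ (K : ℝ) / max ((edges (setGadget n T b)).card : ℝ)
      ((edges (setGadget n T fun _ => 0)).card : ℝ) := by
    convert h
  set M := max ((edges (setGadget n T b)).card : ℝ)
    ((edges (setGadget n T fun _ => 0)).card : ℝ) with hM
  have hMG : ((edges (setGadget n T b)).card : ℝ) ≤ M := le_max_left _ _
  have hMle : M ≤ 4 * n + 88 * T.card := by
    apply max_le
    · exact_mod_cast hG
    · exact_mod_cast hH
  have hM0 : 0 < M := by
    by_contra hM0
    have : (K : ℝ) / M ≤ 0 := div_nonpos_of_nonneg_of_nonpos (by positivity) (not_lt.mp hM0)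
    linarith
  rw [le_div_iff₀ hM0] at h
  have hs : (K : ℝ) + L = (edges (setGadget n T b)).card := by exact_mod_cast hsplit
  have hL : (L : ℝ) ≤ 1 / (95 * c ^ 2) * M := by linarith
  have hn0 : (0 : ℝ) ≤ n := by positivity
  have hfin : 1 / (95 * c ^ 2) * M ≤ n := by
    rw [one_div, inv_mul_le_iff₀ (by positivity)]
    rw [hm] at hMle
    have h1 : (n : ℝ) ≤ c * n := by nlinarith
    have h2 : c * n ≤ c ^ 2 * n := by
      rw [pow_two]; nlinarith
    linarith
  have : (L : ℝ) ≤ n := hL.trans hfin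
  exact hv.trans (by exact_mod_cast this)

/-! ### The union bound -/

lemma count_b {n : ℕ} (T : Finset (Finset (Fin n))) (s : Fin n → ZMod 2) :
    ∑ b : Finset (Fin n) → ZMod 2,
      (1 / 4 : ℝ) ^ (T.filter fun e => ∑ j ∈ e, s j ≠ b e).card =
    (Fintype.card (Finset (Fin n) → ZMod 2) : ℝ) * (5 / 8) ^ T.card := by
  have h1 : ∀ b : Finset (Fin n) → ZMod 2,
      (1 / 4 : ℝ) ^ (T.filter fun e => ∑ j ∈ e, s j ≠ b e).card =
      ∏ e, (if e ∈ T ∧ ∑ j ∈ e, s j ≠ b e then (1 / 4 : ℝ) else 1) := by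
    intro b
    rw [← Finset.prod_filter, Finset.prod_const]
    congr 2
    ext e
    simp
  simp_rw [h1]
  have h2 := Finset.prod_univ_sum (fun _ : Finset (Fin n) => (Finset.univ : Finset (ZMod 2)))
    (fun e a => if e ∈ T ∧ ∑ j ∈ e, s j ≠ a then (1 / 4 : ℝ) else 1)
  rw [Fintype.piFinset_univ] at h2
  rw [← h2]
  have h3 : ∀ e, (∑ a : ZMod 2, if e ∈ T ∧ ∑ j ∈ e, s j ≠ a then (1 / 4 : ℝ) else 1) =
      2 * (if e ∈ T then (5 / 8 : ℝ) else 1) := by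
    intro e
    by_cases he : e ∈ T
    · simp only [he, true_and, if_true]
      generalize ∑ j ∈ e, s j = t
      have ht : t = 0 ∨ t = 1 := by revert t; decide
      have hu : (Finset.univ : Finset (ZMod 2)) = {0, 1} := rfl
      rw [hu, Finset.sum_pair (by decide)]
      rcases ht with rfl | rfl <;> norm_num
    · simp [he, ZMod.card]
  simp_rw [h3]
  rw [Finset.prod_mul_distrib, ← Finset.prod_filter, Finset.prod_const, Finset.prod_const]
  congr 1
  · simp [ZMod.card]
  · congr 2
    ext e
    simp

lemma count_bad {n m : ℕ} (hnm : 10 * n ≤ m) (T : Finset (Finset (Fin n))) (hT : T.card = m) :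
    (((Finset.univ : Finset (Finset (Fin n) → ZMod 2)).filter fun b =>
      ∃ s : Fin n → ZMod 2, (T.filter fun e => ∑ j ∈ e, s j ≠ b e).card ≤ n).card : ℝ) ≤
    (Fintype.card (Finset (Fin n) → ZMod 2) : ℝ) * (1 / 2) ^ n := by
  set N := (Fintype.card (Finset (Fin n) → ZMod 2) : ℝ) with hN
  have hN0 : 0 ≤ N := by positivity
  rw [Finset.card_filter]
  push_cast
  have h1 : ∀ b : Finset (Fin n) → ZMod 2,
      (if ∃ s : Fin n → ZMod 2, (T.filter fun e => ∑ j ∈ e, s j ≠ b e).card ≤ n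
        then (1 : ℝ) else 0) ≤
      ∑ s : Fin n → ZMod 2, 4 ^ n * (1 / 4 : ℝ) ^ (T.filter fun e => ∑ j ∈ e, s j ≠ b e).card := by
    intro b
    split_ifs with h
    · obtain ⟨s, hs⟩ := h
      refine le_trans ?_ (Finset.single_le_sum (f := fun s : Fin n → ZMod 2 =>
        4 ^ n * (1 / 4 : ℝ) ^ (T.filter fun e => ∑ j ∈ e, s j ≠ b e).card)
        (fun i _ => by positivity) (Finset.mem_univ s))
      have : (1 / 4 : ℝ) ^ n ≤ (1 / 4 : ℝ) ^ (T.filter fun e => ∑ j ∈ e, s j ≠ b e).card :=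
        pow_le_pow_of_le_one (by norm_num) (by norm_num) hs
      calc (1 : ℝ) = 4 ^ n * (1 / 4) ^ n := by rw [← mul_pow]; norm_num
        _ ≤ _ := by gcongr
    · positivity
  refine (Finset.sum_le_sum fun b _ => h1 b).trans ?_
  rw [Finset.sum_comm]
  simp_rw [← Finset.mul_sum, count_b, hT]
  rw [Finset.sum_const, Finset.card_univ, Fintype.card_fun, ZMod.card, Fintype.card_fin,
    nsmul_eq_mul, ← hN]
  push_cast
  have h5 : (5 / 8 : ℝ) ^ m ≤ ((5 / 8 : ℝ) ^ 10) ^ n := by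
    rw [← pow_mul]
    exact pow_le_pow_of_le_one (by norm_num) (by norm_num) hnm
  calc (4 : ℝ) ^ n * (2 ^ n * (N * (5 / 8) ^ m))
      ≤ (4 : ℝ) ^ n * (2 ^ n * (N * ((5 / 8 : ℝ) ^ 10) ^ n)) := by gcongr
    _ = N * (2 * 4 * (5 / 8 : ℝ) ^ 10) ^ n := by rw [mul_pow, mul_pow]; ring
    _ ≤ N * (1 / 2) ^ n := by
        gcongr
        norm_num

/-- **Soundness for random instances.**  For any constant `c ≥ 10¹⁰`, a
random 3XOR instance `𝒞` with `n` variables and `m = cn` equations satisfies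
`GI(G_𝒞, G_{homog(𝒞)}) < 1 − 1/(95c²)` with probability `1 − o(1)`. -/
theorem soundness_random (c : ℝ) (hc : 10 ^ 10 ≤ c) :
    ∀ ε : ℝ, 0 < ε → ∃ n₀ : ℕ, ∀ n : ℕ, n₀ ≤ n → ∀ m : ℕ, (m : ℝ) = c * n →
      prob (xorSpace n m)
        (fun p => 1 - 1 / (95 * c ^ 2) ≤
          GI (setGadget n p.1 p.2) (setGadget n p.1 fun _ => 0)) ≤ ε := by
  intro ε hε
  obtain ⟨n₀, hn₀⟩ := exists_pow_lt_of_lt_one hε (show (1 / 2 : ℝ) < 1 by norm_num)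
  refine ⟨n₀, fun n hn m hm => ?_⟩
  have hpow : (1 / 2 : ℝ) ^ n ≤ ε :=
    (pow_le_pow_of_le_one (by norm_num) (by norm_num) hn).trans hn₀.le
  have hnm : 10 * n ≤ m := by
    have hn0 : (0 : ℝ) ≤ n := by positivity
    have : (10 * n : ℝ) ≤ m := by
      rw [hm]
      have : (10 : ℝ) ≤ c := le_trans (by norm_num) hc
      nlinarith
    exact_mod_cast this
  refine le_trans ?_ hpow
  unfold prob
  apply div_le_of_le_mul₀ (by positivity) (by positivity)
  let S : Finset (Finset (Finset (Fin n))) :=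
    Finset.univ.filter fun T => T.card = m ∧ ∀ e ∈ T, e.card = 3
  have hspace : xorSpace n m = S ×ˢ Finset.univ := by
    ext p
    simp [xorSpace, S]
  let B : Finset (Finset (Fin n)) → Finset (Finset (Fin n) → ZMod 2) := fun T =>
    Finset.univ.filter fun b =>
      ∃ s : Fin n → ZMod 2, (T.filter fun e => ∑ j ∈ e, s j ≠ b e).card ≤ n
  have hsub : (xorSpace n m).filter (fun p => 1 - 1 / (95 * c ^ 2) ≤
      GI (setGadget n p.1 p.2) (setGadget n p.1 fun _ => 0)) ⊆
      (S.sigma B).image (fun q => (q.1, q.2)) := by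
    rintro ⟨T, b⟩ hp
    rw [Finset.mem_filter, xorSpace, Finset.mem_filter] at hp
    obtain ⟨⟨-, hcard, hT⟩, hgi⟩ := hp
    rw [Finset.mem_image]
    refine ⟨⟨T, b⟩, ?_, rfl⟩
    simp only [Finset.mem_sigma, S, B, Finset.mem_filter, Finset.mem_univ, true_and]
    refine ⟨⟨hcard, hT⟩, exists_assignment c hc hT ?_ hgi⟩
    have hcard : T.card = m := hcard
    rw [hcard, hm]
  have hle := (Finset.card_le_card hsub).trans Finset.card_image_le
  rw [Finset.card_sigma] at hle
  have hle' : (((xorSpace n m).filter (fun p => 1 - 1 / (95 * c ^ 2) ≤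
      GI (setGadget n p.1 p.2) (setGadget n p.1 fun _ => 0))).card : ℝ) ≤
      ∑ T ∈ S, ((B T).card : ℝ) := by exact_mod_cast hle
  refine hle'.trans ?_
  have hsum : ∑ T ∈ S, ((B T).card : ℝ) ≤
      ∑ T ∈ S, (Fintype.card (Finset (Fin n) → ZMod 2) : ℝ) * (1 / 2) ^ n := by
    apply Finset.sum_le_sum
    intro T hT
    exact count_bad hnm T (Finset.mem_filter.mp hT).2.1
  refine hsum.trans (le_of_eq ?_)
  rw [hspace, Finset.card_product, Finset.sum_const, Finset.card_univ, nsmul_eq_mul]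
  push_cast
  ring

end Giso
end
end

section
/- Let H be a finite abelian group with |H| ≥ 2. Then there exists a finite simple graph G whose vertex set is the disjoint union of a set V_x = {x↦a : a ∈ H} of |H| distinguished vertices and a set V_A of auxiliary vertices with |V_A| ≤ 4·|H|·(log₂|H|)², such that G has at most 7·|H|·(log₂|H|)² edges, the maximum clique of G has size at most min{4, |H|}, and: (Completeness) for every a ∈ H there is a graph automorphism f_a of G with f_a(x↦b) = x↦(a+b) for every b ∈ H; (Soundness) for every graph automorphism f of G there exists a ∈ H such that f(x↦b) = x↦(a+b) for every b ∈ H. -/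
open scoped Classical

noncomputable section

namespace Giso

/-- Generating family of logarithmic size. -/
lemma exists_gen (H : Type) [AddCommGroup H] [Fintype H] :
    ∃ (d : ℕ) (s : Fin d → H), 2 ^ d ≤ Fintype.card H ∧
      AddSubgroup.closure (Set.range s) = ⊤ := by
  let P : ℕ → Prop := fun d => ∃ s : Fin d → H,
    2 ^ d ≤ Nat.card (AddSubgroup.closure (Set.range s))
  have hP0 : P 0 := ⟨Fin.elim0, by
    have : 0 < Nat.card (AddSubgroup.closure (Set.range (Fin.elim0 : Fin 0 → H))) := Nat.card_pos
    simpa using this⟩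
  have hb : ∀ d, P d → 2 ^ d ≤ Fintype.card H := by
    rintro d ⟨s, hs⟩
    refine hs.trans ?_
    rw [← Nat.card_eq_fintype_card]
    exact AddSubgroup.card_le_card_addGroup _
  have hb' : ∀ d, P d → d ≤ Fintype.card H := fun d hd =>
    (Nat.lt_two_pow_self).le.trans (hb d hd)
  have hm : P (Nat.findGreatest P (Fintype.card H)) :=
    Nat.findGreatest_spec (Nat.zero_le _) hP0
  set d := Nat.findGreatest P (Fintype.card H) with hd
  obtain ⟨s, hs⟩ := hm
  refine ⟨d, s, hb d ⟨s, hs⟩, ?_⟩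
  by_contra hne
  obtain ⟨x, hx⟩ : ∃ x, x ∉ AddSubgroup.closure (Set.range s) := by
    by_contra! h
    exact hne ((AddSubgroup.eq_top_iff' _).2 h)
  have hP : P (d + 1) := by
    refine ⟨Fin.cons x s, ?_⟩
    set K := AddSubgroup.closure (Set.range s)
    set K' := AddSubgroup.closure (Set.range (Fin.cons x s : Fin (d+1) → H))
    have hle : K ≤ K' := by
      apply AddSubgroup.closure_mono
      rintro _ ⟨i, rfl⟩
      exact ⟨i.succ, by simp⟩
    have hxK' : x ∈ K' := AddSubgroup.subset_closure ⟨0, by simp⟩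
    have hdvd := AddSubgroup.card_dvd_of_le hle
    obtain ⟨c, hc⟩ := hdvd
    have hpos : 0 < Nat.card K' := Nat.card_pos
    have hc2 : 2 ≤ c := by
      by_contra! hlt
      have : c = 0 ∨ c = 1 := by omega
      rcases this with rfl | rfl
      · omega
      · have : K = K' := AddSubgroup.eq_of_le_of_card_ge hle (by omega)
        exact hx (this ▸ hxK')
    rw [hc, pow_succ]
    exact Nat.mul_le_mul hs hc2
  have := Nat.le_findGreatest (hb' _ hP) hP
  omega

/-- Auxiliary vertices. -/
inductive Aux (H : Type) (d : ℕ) : Type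
  | p (a : H) (i : Fin d) : Aux H d
  | q (a : H) (i : Fin d) : Aux H d
  | lp (a : H) (i : Fin d) (k : Fin (2 * i.1 + 1)) : Aux H d
  | lq (a : H) (i : Fin d) (k : Fin (2 * i.1 + 2)) : Aux H d

/-- Index type of the auxiliary vertices. -/
abbrev Idx (d : ℕ) : Type :=
  (Fin d ⊕ Fin d) ⊕ ((Σ i : Fin d, Fin (2 * i.1 + 1)) ⊕ (Σ i : Fin d, Fin (2 * i.1 + 2)))

/-- Auxiliary vertices as a product. -/
def auxEquiv (H : Type) (d : ℕ) : H × Idx d ≃ Aux H d where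
  toFun
    | (a, .inl (.inl i)) => .p a i
    | (a, .inl (.inr i)) => .q a i
    | (a, .inr (.inl ⟨i, k⟩)) => .lp a i k
    | (a, .inr (.inr ⟨i, k⟩)) => .lq a i k
  invFun
    | .p a i => (a, .inl (.inl i))
    | .q a i => (a, .inl (.inr i))
    | .lp a i k => (a, .inr (.inl ⟨i, k⟩))
    | .lq a i k => (a, .inr (.inr ⟨i, k⟩))
  left_inv := by rintro ⟨a, (i | i) | (⟨i, k⟩ | ⟨i, k⟩)⟩ <;> rfl
  right_inv := by rintro (_ | _ | _ | _) <;> rfl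

instance (H : Type) [Fintype H] (d : ℕ) : Fintype (Aux H d) := Fintype.ofEquiv _ (auxEquiv H d)

lemma sum_aux1 (d : ℕ) : ∑ i : Fin d, (2 * i.1 + 1) = d ^ 2 := by
  rw [Fin.sum_univ_eq_sum_range (fun i => 2 * i + 1)]
  induction d with
  | zero => rfl
  | succ n ih => rw [Finset.sum_range_succ, ih]; ring

lemma sum_aux2 (d : ℕ) : ∑ i : Fin d, (2 * i.1 + 2) = d ^ 2 + d := by
  rw [Fin.sum_univ_eq_sum_range (fun i => 2 * i + 2)]
  induction d with
  | zero => rfl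
  | succ n ih => rw [Finset.sum_range_succ, ih]; ring

lemma card_idx (d : ℕ) : Fintype.card (Idx d) = 2 * d ^ 2 + 3 * d := by
  simp only [Idx, Fintype.card_sum, Fintype.card_sigma, Fintype.card_fin, sum_aux1, sum_aux2]
  ring

lemma card_aux (H : Type) [Fintype H] (d : ℕ) :
    Fintype.card (Aux H d) = Fintype.card H * (2 * d ^ 2 + 3 * d) := by
  rw [← Fintype.card_congr (auxEquiv H d), Fintype.card_prod, card_idx]

variable {H : Type} [AddCommGroup H] {d : ℕ}

/-- Oriented edges of the gadget. -/
inductive R (s : Fin d → H) : H ⊕ Aux H d → H ⊕ Aux H d → Prop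
  | hp (a : H) (i : Fin d) : R s (.inl a) (.inr (.p a i))
  | pq (a : H) (i : Fin d) : R s (.inr (.p a i)) (.inr (.q a i))
  | qh (a : H) (i : Fin d) : R s (.inr (.q a i)) (.inl (a + s i))
  | plp (a : H) (i : Fin d) (k) : R s (.inr (.p a i)) (.inr (.lp a i k))
  | qlq (a : H) (i : Fin d) (k) : R s (.inr (.q a i)) (.inr (.lq a i k))

/-- A proper 3-colouring. -/
def col : H ⊕ Aux H d → Fin 3
  | .inl _ => 0
  | .inr (.p _ _) => 1
  | .inr (.q _ _) => 2
  | .inr (.lp _ _ _) => 0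
  | .inr (.lq _ _ _) => 0

lemma R.col_ne {s : Fin d → H} {u v} (h : R s u v) : col u ≠ col v := by
  cases h <;> simp [col]

/-- The gadget. -/
def gad (s : Fin d → H) : SimpleGraph (H ⊕ Aux H d) where
  Adj u v := R s u v ∨ R s v u
  symm := ⟨fun _ _ h => h.symm⟩
  loopless := ⟨fun _ h => h.elim (fun h => h.col_ne rfl) (fun h => h.col_ne rfl)⟩

lemma gad_adj {s : Fin d → H} {u v} : (gad s).Adj u v ↔ R s u v ∨ R s v u := Iff.rfl

lemma adj_h_p {s : Fin d → H} {a b i} :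
    (gad s).Adj (.inl b) (.inr (.p a i)) ↔ a = b := by
  rw [gad_adj]
  constructor
  · rintro (h | h) <;> cases h <;> rfl
  · rintro rfl; exact .inl (.hp _ _)

lemma adj_p_q {s : Fin d → H} {a b i j} :
    (gad s).Adj (.inr (.p a i)) (.inr (.q b j)) ↔ a = b ∧ i = j := by
  rw [gad_adj]
  constructor
  · rintro (h | h) <;> cases h <;> exact ⟨rfl, rfl⟩
  · rintro ⟨rfl, rfl⟩; exact .inl (.pq _ _)

lemma adj_q_h {s : Fin d → H} {a b i} :
    (gad s).Adj (.inr (.q a i)) (.inl b) ↔ b = a + s i := by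
  rw [gad_adj]
  constructor
  · rintro (h | h) <;> cases h <;> rfl
  · rintro rfl; exact .inl (.qh _ _)

lemma adj_lp {s : Fin d → H} {a i k u} :
    (gad s).Adj (.inr (.lp a i k)) u ↔ u = .inr (.p a i) := by
  rw [gad_adj]
  constructor
  · rintro (h | h) <;> cases h <;> rfl
  · rintro rfl; exact .inr (.plp _ _ _)

lemma adj_lq {s : Fin d → H} {a i k u} :
    (gad s).Adj (.inr (.lq a i k)) u ↔ u = .inr (.q a i) := by
  rw [gad_adj]
  constructor
  · rintro (h | h) <;> cases h <;> rfl
  · rintro rfl; exact .inr (.qlq _ _ _)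

/-- Leaves. -/
def Leaf {V : Type} (G : SimpleGraph V) (u : V) : Prop := ∃ w, ∀ x, G.Adj u x ↔ x = w

/-- Leaf neighbours. -/
def leaves {V : Type} (G : SimpleGraph V) (v : V) : Set V := {u | G.Adj v u ∧ Leaf G u}

lemma not_leaf {V : Type} {G : SimpleGraph V} {u x y : V} (hx : G.Adj u x) (hy : G.Adj u y)
    (h : x ≠ y) : ¬ Leaf G u := by
  rintro ⟨w, hw⟩
  exact h (((hw x).1 hx).trans ((hw y).1 hy).symm)

lemma leaf_map {V : Type} {G : SimpleGraph V} (f : G ≃g G) (u : V) :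
    Leaf G (f u) ↔ Leaf G u := by
  constructor
  · rintro ⟨w, hw⟩
    refine ⟨f.symm w, fun x => ?_⟩
    rw [← f.map_adj_iff, hw]
    exact (f.toEquiv.apply_eq_iff_eq_symm_apply)
  · rintro ⟨w, hw⟩
    refine ⟨f w, fun x => ?_⟩
    obtain ⟨y, rfl⟩ := f.surjective x
    rw [f.map_adj_iff, hw]
    exact f.injective.eq_iff.symm

lemma leaves_map {V : Type} {G : SimpleGraph V} (f : G ≃g G) (u : V) :
    (leaves G (f u)).ncard = (leaves G u).ncard := by
  rw [← Set.ncard_image_of_injective (leaves G u) f.injective]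
  congr 1
  ext x
  obtain ⟨y, rfl⟩ := f.surjective x
  simp only [leaves, Set.mem_setOf_eq, f.map_adj_iff, leaf_map, Set.mem_image]
  constructor
  · intro h; exact ⟨y, h, rfl⟩
  · rintro ⟨z, hz, e⟩
    rw [← f.injective e]; exact hz

lemma leaf_lp (s : Fin d → H) (a i k) : Leaf (gad s) (.inr (.lp a i k)) :=
  ⟨_, fun _ => adj_lp⟩

lemma leaf_lq (s : Fin d → H) (a i k) : Leaf (gad s) (.inr (.lq a i k)) :=
  ⟨_, fun _ => adj_lq⟩

lemma not_leaf_p (s : Fin d → H) (a i) : ¬ Leaf (gad s) (.inr (.p a i)) :=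
  not_leaf (adj_h_p.2 rfl).symm (adj_p_q.2 ⟨rfl, rfl⟩) (by simp)

lemma not_leaf_q (s : Fin d → H) (a i) : ¬ Leaf (gad s) (.inr (.q a i)) :=
  not_leaf (adj_q_h.2 rfl) (adj_p_q.2 ⟨rfl, rfl⟩).symm (by simp)

lemma not_leaf_h (hd : 0 < d) (s : Fin d → H) (a) : ¬ Leaf (gad s) (.inl a) :=
  not_leaf (x := .inr (.p a ⟨0, hd⟩)) (y := .inr (.q (a - s ⟨0, hd⟩) ⟨0, hd⟩))
    (adj_h_p.2 rfl) (adj_q_h.2 (by simp)).symm (by simp)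

lemma leaves_h (s : Fin d → H) (a) : (leaves (gad s) (.inl a)).ncard = 0 := by
  have : leaves (gad s) (.inl a) = ∅ := by
    ext u
    simp only [leaves, Set.mem_setOf_eq, Set.mem_empty_iff_false, iff_false, not_and]
    rintro (h | h) <;> cases h
    · exact not_leaf_p _ _ _
    · exact not_leaf_q _ _ _
  simp [this]

lemma leaves_p (s : Fin d → H) (a i) : (leaves (gad s) (.inr (.p a i))).ncard = 2 * i.1 + 1 := by
  have : leaves (gad s) (.inr (.p a i)) =
      Set.range (fun k : Fin (2 * i.1 + 1) => (.inr (.lp a i k) : H ⊕ Aux H d)) := by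
    ext u
    simp only [leaves, Set.mem_setOf_eq, Set.mem_range]
    constructor
    · rintro ⟨h, hl⟩
      by_contra hne
      by_cases hn : 0 < d
      · rcases h with h | h <;> cases h
        · exact not_leaf_q _ _ _ hl
        · exact hne ⟨_, rfl⟩
        · exact not_leaf_h hn _ _ hl
      · exact hn i.pos
    · rintro ⟨k, rfl⟩
      exact ⟨(adj_lp.2 rfl).symm, leaf_lp _ _ _ _⟩
  rw [this, ← Set.image_univ, Set.ncard_image_of_injective, Set.ncard_univ, Nat.card_fin]
  intro k l h
  simpa using h

lemma leaves_q (s : Fin d → H) (a i) : (leaves (gad s) (.inr (.q a i))).ncard = 2 * i.1 + 2 := by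
  have : leaves (gad s) (.inr (.q a i)) =
      Set.range (fun k : Fin (2 * i.1 + 2) => (.inr (.lq a i k) : H ⊕ Aux H d)) := by
    ext u
    simp only [leaves, Set.mem_setOf_eq, Set.mem_range]
    constructor
    · rintro ⟨h, hl⟩
      by_contra hne
      rcases h with h | h <;> cases h
      · exact not_leaf_h i.pos _ _ hl
      · exact hne ⟨_, rfl⟩
      · exact not_leaf_p _ _ _ hl
    · rintro ⟨k, rfl⟩
      exact ⟨(adj_lq.2 rfl).symm, leaf_lq _ _ _ _⟩
  rw [this, ← Set.image_univ, Set.ncard_image_of_injective, Set.ncard_univ, Nat.card_fin]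
  intro k l h
  simpa using h

/-- An automorphism preserves the distinguished vertices. -/
lemma map_h (hd : 0 < d) (s : Fin d → H) (f : gad s ≃g gad s) (a : H) :
    ∃ b, f (.inl a) = .inl b := by
  have h1 := leaves_map f (.inl a)
  have h2 := (leaf_map f (.inl a)).not.2 (not_leaf_h hd s a)
  rw [leaves_h] at h1
  rcases h : f (.inl a) with b | (⟨b, j⟩ | ⟨b, j⟩ | ⟨b, j, k⟩ | ⟨b, j, k⟩)
  · exact ⟨b, rfl⟩
  · rw [h, leaves_p] at h1; omega
  · rw [h, leaves_q] at h1; omega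
  · rw [h] at h2; exact absurd (leaf_lp _ _ _ _) h2
  · rw [h] at h2; exact absurd (leaf_lq _ _ _ _) h2

lemma map_p (s : Fin d → H) (f : gad s ≃g gad s) (a : H) (i : Fin d) :
    ∃ b, f (.inr (.p a i)) = .inr (.p b i) := by
  have h1 := leaves_map f (.inr (.p a i))
  have h2 := (leaf_map f _).not.2 (not_leaf_p s a i)
  rw [leaves_p] at h1
  rcases h : f (.inr (.p a i)) with b | (⟨b, j⟩ | ⟨b, j⟩ | ⟨b, j, k⟩ | ⟨b, j, k⟩)
  · rw [h, leaves_h] at h1; omega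
  · rw [h, leaves_p] at h1
    obtain rfl : j = i := Fin.ext (by omega)
    exact ⟨b, rfl⟩
  · rw [h, leaves_q] at h1; omega
  · rw [h] at h2; exact absurd (leaf_lp _ _ _ _) h2
  · rw [h] at h2; exact absurd (leaf_lq _ _ _ _) h2

lemma map_q (s : Fin d → H) (f : gad s ≃g gad s) (a : H) (i : Fin d) :
    ∃ b, f (.inr (.q a i)) = .inr (.q b i) := by
  have h1 := leaves_map f (.inr (.q a i))
  have h2 := (leaf_map f _).not.2 (not_leaf_q s a i)
  rw [leaves_q] at h1
  rcases h : f (.inr (.q a i)) with b | (⟨b, j⟩ | ⟨b, j⟩ | ⟨b, j, k⟩ | ⟨b, j, k⟩)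
  · rw [h, leaves_h] at h1; omega
  · rw [h, leaves_p] at h1; omega
  · rw [h, leaves_q] at h1
    obtain rfl : j = i := Fin.ext (by omega)
    exact ⟨b, rfl⟩
  · rw [h] at h2; exact absurd (leaf_lp _ _ _ _) h2
  · rw [h] at h2; exact absurd (leaf_lq _ _ _ _) h2

lemma sound (hd : 0 < d) (s : Fin d → H) (hs : AddSubgroup.closure (Set.range s) = ⊤)
    (f : gad s ≃g gad s) : ∃ a : H, ∀ b : H, f (.inl b) = .inl (a + b) := by
  choose φ hφ using map_h hd s f
  have key : ∀ i a, φ (a + s i) = φ a + s i := by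
    intro i a
    obtain ⟨b, hb⟩ := map_p s f a i
    obtain ⟨c, hc⟩ := map_q s f a i
    have h1 := f.map_adj_iff.2 (adj_h_p (s := s) (i := i).2 (rfl : a = a))
    have h2 := f.map_adj_iff.2 (adj_p_q (s := s).2 ⟨(rfl : a = a), (rfl : i = i)⟩)
    have h3 := f.map_adj_iff.2 (adj_q_h (s := s).2 (rfl : a + s i = a + s i))
    rw [hφ, hb, adj_h_p] at h1
    rw [hb, hc, adj_p_q] at h2
    rw [hc, hφ, adj_q_h] at h3
    rw [h3, ← h2.1, h1]
  have all : ∀ h : H, ∀ a, φ (a + h) = φ a + h := by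
    intro h
    have hm : h ∈ AddSubgroup.closure (Set.range s) := by rw [hs]; trivial
    induction hm using AddSubgroup.closure_induction with
    | mem x hx => obtain ⟨i, rfl⟩ := hx; exact key i
    | zero => simp
    | add x y _ _ hx hy => intro a; rw [← add_assoc, hy, hx, add_assoc]
    | neg x _ hx =>
      intro a
      have := hx (a + -x)
      rw [neg_add_cancel_right] at this
      rw [this, add_neg_cancel_right]
  refine ⟨φ 0, fun b => ?_⟩
  rw [hφ, ← all, zero_add]

/-- Translation of the vertices. -/
def tr (c : H) : H ⊕ Aux H d → H ⊕ Aux H d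
  | .inl a => .inl (c + a)
  | .inr (.p a i) => .inr (.p (c + a) i)
  | .inr (.q a i) => .inr (.q (c + a) i)
  | .inr (.lp a i k) => .inr (.lp (c + a) i k)
  | .inr (.lq a i k) => .inr (.lq (c + a) i k)

lemma tr_tr (c e : H) (u : H ⊕ Aux H d) (h : c + e = 0) : tr c (tr e u) = u := by
  rcases u with b | (⟨b, j⟩ | ⟨b, j⟩ | ⟨b, j, k⟩ | ⟨b, j, k⟩) <;>
    simp [tr, ← add_assoc, h]

lemma R.tr {s : Fin d → H} {u v} (c : H) (h : R s u v) : R s (tr c u) (tr c v) := by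
  cases h with
  | hp a i => exact .hp _ _
  | pq a i => exact .pq _ _
  | qh a i =>
    have := R.qh (s := s) (c + a) i
    rw [add_assoc] at this
    exact this
  | plp a i k => exact .plp _ _ _
  | qlq a i k => exact .qlq _ _ _

lemma complete (s : Fin d → H) (a : H) :
    ∃ f : gad s ≃g gad s, ∀ b : H, f (.inl b) = .inl (a + b) := by
  refine ⟨⟨⟨tr a, tr (-a), fun u => tr_tr _ _ _ (by simp), fun u => tr_tr _ _ _ (by simp)⟩, ?_⟩,
    fun b => rfl⟩
  intro u v
  have hm : ∀ c {u v}, (gad s).Adj u v → (gad s).Adj (tr c u) (tr c v) :=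
    fun c _ _ h => h.imp (R.tr c) (R.tr c)
  constructor
  · intro h
    have := hm (-a) h
    simpa [tr_tr] using this
  · exact hm a

/-- Edge enumeration. -/
def edg (s : Fin d → H) : H × (Idx d ⊕ Fin d) → Sym2 (H ⊕ Aux H d)
  | (a, .inl (.inl (.inl i))) => s(.inl a, .inr (.p a i))
  | (a, .inl (.inl (.inr i))) => s(.inr (.p a i), .inr (.q a i))
  | (a, .inl (.inr (.inl ⟨i, k⟩))) => s(.inr (.p a i), .inr (.lp a i k))
  | (a, .inl (.inr (.inr ⟨i, k⟩))) => s(.inr (.q a i), .inr (.lq a i k))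
  | (a, .inr i) => s(.inr (.q a i), .inl (a + s i))

lemma R.edg {s : Fin d → H} {u v} (h : R s u v) : s(u, v) ∈ Set.range (edg s) := by
  cases h with
  | hp a i => exact ⟨(a, .inl (.inl (.inl i))), rfl⟩
  | pq a i => exact ⟨(a, .inl (.inl (.inr i))), rfl⟩
  | qh a i => exact ⟨(a, .inr i), rfl⟩
  | plp a i k => exact ⟨(a, .inl (.inr (.inl ⟨i, k⟩))), rfl⟩
  | qlq a i k => exact ⟨(a, .inl (.inr (.inr ⟨i, k⟩))), rfl⟩

lemma edges_s17 [Fintype H] (s : Fin d → H) :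
    (gad s).edgeSet.ncard ≤ Fintype.card H * (2 * d ^ 2 + 4 * d) := by
  have hsub : (gad s).edgeSet ⊆ Set.range (edg s) := by
    intro e
    induction e with
    | h u v =>
      intro h
      rcases h with h | h
      · exact h.edg
      · rw [Sym2.eq_swap]; exact h.edg
  calc (gad s).edgeSet.ncard ≤ (Set.range (edg s)).ncard :=
        Set.ncard_le_ncard hsub (Set.finite_range _)
    _ ≤ (Set.univ : Set (H × (Idx d ⊕ Fin d))).ncard := by
        rw [← Set.image_univ]; exact Set.ncard_image_le Set.finite_univ
    _ = Fintype.card H * (2 * d ^ 2 + 4 * d) := by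
        rw [Set.ncard_univ, Nat.card_eq_fintype_card, Fintype.card_prod, Fintype.card_sum,
          card_idx, Fintype.card_fin]
        ring

lemma clique (s : Fin d → H) (t : Finset (H ⊕ Aux H d)) (ht : (gad s).IsClique ↑t) :
    t.card ≤ 3 := by
  have := Finset.card_le_card_of_injOn (s := t) (t := (Finset.univ : Finset (Fin 3))) col
    (fun _ _ => by simp) (by
      intro u hu v hv h
      by_contra hne
      rcases ht hu hv hne with h' | h'
      · exact h'.col_ne h
      · exact h'.col_ne h.symm)
  simpa using this

/-- **Variable gadget.**  For every finite abelian group `H` with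
`|H| ≥ 2` there is a finite simple graph on vertex set `H ⊕ A` — the summand `H`
playing the role of the distinguished vertices `x ↦ a` and `A` the auxiliary
vertices — with `|A| ≤ 4|H|(log₂|H|)²`, at most `7|H|(log₂|H|)²` edges, maximum clique
size at most `min{4, |H|}`, whose automorphisms restricted to the distinguished
vertices are exactly the translations of `H`. -/
theorem variable_gadget (H : Type) [AddCommGroup H] [Fintype H]
    (hH : 2 ≤ Fintype.card H) :
    ∃ (A : Type) (_ : Fintype A) (G : SimpleGraph (H ⊕ A)),
      (Fintype.card A : ℝ) ≤
        4 * (Fintype.card H : ℝ) * Real.logb 2 (Fintype.card H) ^ 2 ∧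
      (G.edgeSet.ncard : ℝ) ≤
        7 * (Fintype.card H : ℝ) * Real.logb 2 (Fintype.card H) ^ 2 ∧
      (∀ s : Finset (H ⊕ A), G.IsClique ↑s → s.card ≤ min 4 (Fintype.card H)) ∧
      (∀ a : H, ∃ f : G ≃g G, ∀ b : H, f (Sum.inl b) = Sum.inl (a + b)) ∧
      (∀ f : G ≃g G, ∃ a : H, ∀ b : H, f (Sum.inl b) = Sum.inl (a + b)) := by
  rcases hH.eq_or_lt with h2 | h3
  · refine ⟨Empty, inferInstance, ⊥, ?_, ?_, ?_, ?_, ?_⟩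
    · simp only [Fintype.card_empty, Nat.cast_zero]; positivity
    · simp only [SimpleGraph.edgeSet_bot, Set.ncard_empty, Nat.cast_zero]; positivity
    · intro s _
      have := Finset.card_le_univ s
      simp only [Fintype.card_sum, Fintype.card_empty] at this
      omega
    · intro a
      refine ⟨⟨Equiv.sumCongr (Equiv.addLeft a) (Equiv.refl _), ?_⟩, fun b => rfl⟩
      intro u v; simp
    · intro f
      have hex : ∀ b, ∃ c, f (.inl b) = .inl c := by
        intro b
        rcases h : f (.inl b) with c | c
        · exact ⟨c, rfl⟩
        · exact c.elim
      choose φ hφ using hex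
      refine ⟨φ 0, fun b => ?_⟩
      rw [hφ]
      by_cases hb : b = 0
      · simp [hb]
      · have h1 : φ b ≠ φ 0 := by
          intro h
          have : f (.inl b) = f (.inl 0) := by rw [hφ, hφ, h]
          exact hb (by simpa using f.injective this)
        have h2' : φ 0 + b ≠ φ 0 := by simpa using hb
        by_contra hne
        have hne' : φ b ≠ φ 0 + b := fun h => hne (by rw [h])
        have hc : ({φ 0, φ b, φ 0 + b} : Finset H).card = 3 :=
          Finset.card_eq_three.2 ⟨_, _, _, h1.symm, h2'.symm, hne', rfl⟩
        have := Finset.card_le_univ ({φ 0, φ b, φ 0 + b} : Finset H)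
        omega
  · obtain ⟨d, s, hd, hs⟩ := exists_gen H
    have hd0 : 0 < d := by
      rcases Nat.eq_zero_or_pos d with rfl | h
      · exfalso
        have hr : Set.range s = ∅ := Set.range_eq_empty s
        rw [hr, AddSubgroup.closure_empty] at hs
        have h1 : Nat.card (⊥ : AddSubgroup H) = Nat.card (⊤ : AddSubgroup H) := by rw [hs]
        rw [AddSubgroup.card_bot, AddSubgroup.card_top, Nat.card_eq_fintype_card] at h1
        omega
      · exact h
    have hn0 : (0 : ℝ) < Fintype.card H := by
      have : 0 < Fintype.card H := by omega
      exact_mod_cast this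
    have hdL : (d : ℝ) ≤ Real.logb 2 (Fintype.card H) := by
      rw [Real.le_logb_iff_rpow_le (by norm_num) hn0, Real.rpow_natCast]
      exact_mod_cast hd
    have hL : (3 / 2 : ℝ) ≤ Real.logb 2 (Fintype.card H) := by
      have h8 : (3 : ℝ) ≤ Real.logb 2 ((Fintype.card H : ℝ) ^ 2) := by
        rw [Real.le_logb_iff_rpow_le (by norm_num) (by positivity)]
        have h3' : (3 : ℝ) ≤ Fintype.card H := by exact_mod_cast h3
        have : (2 : ℝ) ^ (3 : ℝ) = 8 := by norm_num
        rw [this]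
        nlinarith
      rw [Real.logb_pow] at h8
      push_cast at h8
      linarith
    have hdn : (0 : ℝ) ≤ d := Nat.cast_nonneg d
    refine ⟨Aux H d, inferInstance, gad s, ?_, ?_, ?_, complete s, sound hd0 s hs⟩
    · rw [card_aux]
      push_cast
      rw [mul_comm 4, mul_assoc]
      apply mul_le_mul_of_nonneg_left _ hn0.le
      nlinarith
    · have he : ((gad s).edgeSet.ncard : ℝ) ≤
          ((Fintype.card H * (2 * d ^ 2 + 4 * d) : ℕ) : ℝ) := by exact_mod_cast edges_s17 s
      refine he.trans ?_
      push_cast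
      rw [mul_comm 7, mul_assoc]
      apply mul_le_mul_of_nonneg_left _ hn0.le
      nlinarith
    · intro t ht
      have := clique s t ht
      omega

end Giso
end
end
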